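/- arXiv:2111.04234 — 2 statements merged into one kernel-verified Lean document; each statement's English description precedes it below -/
import Mathlib

section
/- There exists a constant c = c(r) ∈ ℕ depending only on r such that whenever p > c and q ≡ 1 (mod r) the following holds: for any two distinct nonzero prime ideals 𝔩₁ ≠ 𝔩₂ of A, the mod 𝔩₁𝔩₂ Galois representation of φ is surjective; that is, every A/(𝔩₁𝔩₂)-module automorphism of φ[𝔩₁𝔩₂] is the restriction of some σ ∈ Gal(F̄/F). -/
open Polynomial

noncomputable section

/-- `F̄`: a fixed algebraic closure of `F = 𝔽_q(T)`. -/
abbrev Kbar (Fq : Type) [Field Fq] := AlgebraicClosure (RatFunc Fq)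

/-- `φ` is (encodes) the rank-`r` Drinfeld `𝔽_q[T]`-module over `𝔽_q(T)` given by
`φ_T = T + τ^{r-1} + T^{q-1} τ^r`: it is a ring homomorphism from `A = 𝔽_q[T]` to the
additive endomorphisms of `F̄` which is `𝔽_q`-linear (the condition on `C c`) and sends
`T` to `x ↦ T·x + x^{q^{r-1}} + T^{q-1}·x^{q^r}`. -/
def IsDrinfeldPhi (Fq : Type) [Field Fq] (q r : ℕ)
    (φ : Polynomial Fq →+* AddMonoid.End (Kbar Fq)) : Prop :=
  (∀ (c : Fq) (x : Kbar Fq),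
      φ (C c) x = algebraMap (RatFunc Fq) (Kbar Fq) (RatFunc.C c) * x) ∧
  (∀ x : Kbar Fq, φ X x =
      algebraMap (RatFunc Fq) (Kbar Fq) RatFunc.X * x + x ^ q ^ (r - 1) +
        algebraMap (RatFunc Fq) (Kbar Fq) RatFunc.X ^ (q - 1) * x ^ q ^ r)

/-- The `a`-torsion `φ[a] ⊆ F̄`. -/
def phiTorsion (Fq : Type) [Field Fq] (φ : Polynomial Fq →+* AddMonoid.End (Kbar Fq))
    (a : Polynomial Fq) : Set (Kbar Fq) := {x | φ a x = 0}

/-- `g` is an `A/(a)`-module automorphism of `φ[a]`: a bijection of `φ[a]` with itself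
which is additive and commutes with the `A`-action through `φ`. -/
def IsTorsionAut (Fq : Type) [Field Fq] (φ : Polynomial Fq →+* AddMonoid.End (Kbar Fq))
    (a : Polynomial Fq) (g : Kbar Fq → Kbar Fq) : Prop :=
  Set.BijOn g (phiTorsion Fq φ a) (phiTorsion Fq φ a) ∧
  (∀ x ∈ phiTorsion Fq φ a, ∀ y ∈ phiTorsion Fq φ a, g (x + y) = g x + g y) ∧
  (∀ b : Polynomial Fq, ∀ x ∈ phiTorsion Fq φ a, g (φ b x) = φ b (g x))

section Transvections

open Module Submodule
open LinearEquiv hiding map_smul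
open scoped Pointwise

variable {κ V : Type*} [Field κ] [AddCommGroup V] [Module κ V] [FiniteDimensional κ V]

theorem exists_transvection_mul_mem (e : V ≃ₗ[κ] V) :
    ∃ t ∈ transvections κ V, ∃ n : ℕ, t * e ∈ transvections κ V ^ n * dilatransvections κ V := by
  by_cases hh : ∀ a : κ, ∃ x, e.fixedReduce x ≠ a • x
  · exact ⟨1, one_mem_transvections, _, by
      simpa using mem_transvections_pow_mul_dilatransvections_of_fixedReduce_ne_smul_id hh⟩
  push Not at hh
  obtain ⟨a, ha⟩ := hh
  rw [fixedReduce_eq_smul_iff] at ha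
  by_cases hn : finrank κ (V ⧸ e.fixedSubmodule) ≤ 1
  · refine ⟨1, one_mem_transvections, 0, ?_⟩
    simpa [mem_dilatransvections_iff_finrank_quotient] using hn
  by_cases ha1 : a = 1
  · refine ⟨1, one_mem_transvections, finrank κ (V ⧸ e.fixedSubmodule) - 1, ?_⟩
    rw [one_mul]
    apply mem_transvections_pow_mul_dilatransvections_of_fixedReduce_eq_one
    change _ = LinearEquiv.refl _ _
    rw [fixedReduce_eq_one]
    simpa [ha1] using ha
  push Not at hn
  set W := e.fixedSubmodule with hW
  obtain ⟨u, hu⟩ : ∃ u, u ∉ W := by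
    by_contra! h
    rw [← Submodule.eq_top_iff'] at h
    have := finrank_quotient_add_finrank W
    rw [h, finrank_top] at this
    rw [h] at hn
    omega
  obtain ⟨f, hf0, hf⟩ : ∃ f : Dual κ V, f ≠ 0 ∧ W ⊔ κ ∙ u ≤ LinearMap.ker f := by
    obtain ⟨f, hf0, hf⟩ := Submodule.exists_dual_map_eq_bot_of_lt_top
      (sup_span_singleton_lt_top u hn) inferInstance
    exact ⟨f, hf0, (LinearMap.le_ker_iff_map).2 hf⟩
  have hfu : f u = 0 := hf (mem_sup_right (mem_span_singleton_self u))
  have hfW : ∀ x ∈ W, f x = 0 := fun x hx => hf (mem_sup_left hx)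
  obtain ⟨v, hv⟩ : ∃ v, f v ≠ 0 := by
    by_contra! h
    exact hf0 (LinearMap.ext h)
  have hfe : ∀ x, f (e x) = a * f x := fun x => by
    have := hfW _ (ha x)
    rwa [map_sub, map_smul, smul_eq_mul, sub_eq_zero] at this
  refine ⟨transvection hfu, mem_transvections hfu, _,
    mem_transvections_pow_mul_dilatransvections_of_fixedReduce_ne_smul_id ?_⟩
  have hte : ∀ x, (transvection hfu * e) x = e x + (a * f x) • u := fun x => by
    rw [LinearEquiv.mul_apply, transvection.apply, hfe]
  have hsub : ∀ x, x ∈ (transvection hfu * e).fixedSubmodule → x ∈ W := by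
    intro x hx
    rw [LinearMap.mem_fixedSubmodule_iff, LinearEquiv.coe_coe, hte] at hx
    have h1 := congrArg f hx
    rw [map_add, map_smul, hfu, hfe, smul_zero, add_zero] at h1
    have h2 : f x = 0 := by
      by_contra h
      exact ha1 (mul_right_cancel₀ h (by rw [h1, one_mul]))
    rw [h2, mul_zero, zero_smul, add_zero] at hx
    exact LinearMap.mem_fixedSubmodule_iff.2 hx
  intro b
  by_contra! hb
  rw [fixedReduce_eq_smul_iff] at hb
  have key : ∀ x, (a - b) • x + (a * f x) • u ∈ W := by
    intro x
    have h1 := hsub _ (hb x)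
    rw [hte] at h1
    have h2 := W.sub_mem h1 (ha x)
    convert h2 using 1
    module
  have ha0 : a ≠ 0 := by
    rintro rfl
    obtain ⟨y, hy⟩ := e.surjective v
    rw [← hy, hfe, zero_mul] at hv
    exact hv rfl
  have hab : a - b = 0 := by
    by_contra h
    have := key u
    rw [hfu, mul_zero, zero_smul, add_zero] at this
    exact hu ((W.smul_mem_iff h).1 this)
  have := key v
  rw [hab, zero_smul, zero_add] at this
  exact hu ((W.smul_mem_iff (mul_ne_zero ha0 hv)).1 this)

theorem mem_of_transvections_subset {M : Subgroup (V ≃ₗ[κ] V)} (hM : transvections κ V ⊆ M)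
    {e : V ≃ₗ[κ] V} (he : LinearMap.det (e : V →ₗ[κ] V) = 1) : e ∈ M := by
  obtain ⟨t, ht, n, m, hm, d, hd, hmd⟩ := exists_transvection_mul_mem e
  have hdet1 : transvections κ V ⊆ (LinearEquiv.det (M := V) (R := κ)).ker := by
    rintro _ ⟨f, v, hfv, rfl⟩
    exact transvection.det_eq_one hfv
  have hpow : ∀ {N : Subgroup (V ≃ₗ[κ] V)}, transvections κ V ⊆ N → ∀ {n : ℕ},
      transvections κ V ^ n ⊆ N := by
    intro N hN n
    induction n with
    | zero => simp
    | succ n ih =>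
      rw [pow_succ]
      rintro _ ⟨a, ha, b, hb, rfl⟩
      exact N.mul_mem (ih ha) (hN hb)
  have hdM : d ∈ transvections κ V := by
    have h1 : LinearEquiv.det d = 1 := by
      have h2 := congrArg (fun u => LinearEquiv.det u) hmd
      rw [map_mul, map_mul, (hdet1 ht : LinearEquiv.det t = 1),
        (hpow hdet1 hm : LinearEquiv.det m = 1), one_mul, one_mul] at h2
      rw [h2]
      exact Units.ext ((LinearEquiv.coe_det e).trans he)
    obtain ⟨f, v, hfv⟩ := hd
    have h3 : LinearMap.det (d : V →ₗ[κ] V) = 1 :=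
      (LinearEquiv.coe_det d).symm.trans (congrArg Units.val h1)
    rw [hfv, LinearMap.transvection.det, add_eq_left] at h3
    exact ⟨f, v, h3, LinearEquiv.toLinearMap_injective hfv⟩
  have : e = t⁻¹ * (m * d) := by rw [eq_inv_mul_iff_mul_eq]; exact hmd.symm
  rw [this]
  exact M.mul_mem (M.inv_mem (hM ht)) (M.mul_mem (hpow hM hm) (hM hdM))

variable {Γ : Type*} [Group Γ] (ρ : Γ →* (V ≃ₗ[κ] V)) (N : Subgroup Γ) [N.Normal]

/-- A representation that is irreducible, with a normal subgroup whose image contains all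
transvections along one hyperplane, has image containing the special linear group. -/
theorem exists_mem_normal_of_det_eq_one {f₀ : Dual κ V} (hf₀ : f₀ ≠ 0)
    (htr : ∀ w, f₀ w = 0 → ∃ n ∈ N, ∀ v, ρ n v = v + f₀ v • w)
    (hirr : ∀ U : Submodule κ V, (∀ σ, ∀ u ∈ U, ρ σ u ∈ U) → U = ⊥ ∨ U = ⊤)
    {g : V ≃ₗ[κ] V} (hg : LinearMap.det (g : V →ₗ[κ] V) = 1) : ∃ n ∈ N, ρ n = g := by
  let S : Set (Dual κ V) := {f | ∀ w, f w = 0 → ∃ n ∈ N, ∀ v, ρ n v = v + f v • w}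
  have hsmul : ∀ (c : κ), ∀ f ∈ S, c • f ∈ S := by
    intro c f hf w hw
    obtain ⟨n, hn, h⟩ := hf (c • w) (by simpa using hw)
    refine ⟨n, hn, fun v => ?_⟩
    rw [h, LinearMap.smul_apply, smul_smul, smul_eq_mul, mul_comm]
  have hcomp : ∀ σ : Γ, ∀ f ∈ S, f ∘ₗ (ρ σ : V →ₗ[κ] V) ∈ S := by
    intro σ f hf w hw
    obtain ⟨n, hn, h⟩ := hf (ρ σ w) hw
    refine ⟨σ⁻¹ * n * σ, ?_, fun v => ?_⟩
    · simpa using (inferInstance : N.Normal).conj_mem n hn σ⁻¹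
    · rw [map_mul, map_mul, LinearEquiv.mul_apply, LinearEquiv.mul_apply, h, map_add, map_smul,
        ← LinearEquiv.mul_apply, ← LinearEquiv.mul_apply, ← map_mul, inv_mul_cancel, map_one]
      rfl
  have hadd : ∀ f ∈ S, ∀ g ∈ S, f + g ∈ S := by
    intro f hf g hg
    by_cases hw : ∃ w, f w = 0 ∧ g w ≠ 0
    · obtain ⟨w, hfw, hgw⟩ := hw
      obtain ⟨n, -, h⟩ := hf ((g w)⁻¹ • w) (by rw [map_smul, hfw, smul_zero])
      have := hcomp n g hg
      convert this using 1
      ext v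
      simp [h, hgw, add_comm]
    · push Not at hw
      have : g ∈ Submodule.span κ (Set.range fun _ : Unit => f) :=
        mem_span_of_iInf_ker_le_ker (by
          intro x hx
          exact hw x (by simpa using hx))
      simp only [Set.range_const] at this
      obtain ⟨c, rfl⟩ := Submodule.mem_span_singleton.1 this
      have := hsmul (1 + c) f hf
      rwa [add_smul, one_smul] at this
  let S' : Submodule κ (Dual κ V) :=
    { carrier := S
      add_mem' := fun {a b} ha hb => hadd a ha b hb
      zero_mem' := by simpa using hsmul 0 f₀ htr
      smul_mem' := fun c f hf => hsmul c f hf }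
  have hbot : S'.dualCoannihilator = ⊥ := by
    refine (hirr S'.dualCoannihilator ?_).resolve_right ?_
    · intro σ u hu
      rw [Submodule.mem_dualCoannihilator] at hu ⊢
      exact fun f hf => hu _ (hcomp σ f hf)
    · intro h
      refine hf₀ (LinearMap.ext fun v => ?_)
      have : v ∈ S'.dualCoannihilator := h ▸ Submodule.mem_top
      exact (Submodule.mem_dualCoannihilator _).1 this f₀ htr
  have htop : S' = ⊤ := by
    rw [← Subspace.dualCoannihilator_dualAnnihilator_eq (W := S'), hbot,
      Submodule.dualAnnihilator_bot]
  have hM : transvections κ V ⊆ N.map ρ := by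
    rintro _ ⟨f, w, hfw, rfl⟩
    have hf : f ∈ S' := htop ▸ Submodule.mem_top
    obtain ⟨n, hn, h⟩ := hf w hfw
    exact ⟨n, hn, LinearEquiv.ext h⟩
  exact mem_of_transvections_subset hM hg

end Transvections

section LaurentNorm

open scoped LaurentSeries NNReal

variable (k : Type) [Field k]

/-- The `X`-adic valuation of `k((X))` has rank one. -/
@[reducible] def laurentRankOne : Valuation.RankOne (Valued.v : Valuation k⸨X⸩ (WithZero (Multiplicative ℤ))) where
  hom' := (WithZeroMulInt.toNNReal (e := 2) (by norm_num)).comp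
    MonoidWithZeroHom.ValueGroup₀.embedding
  strictMono' := (WithZeroMulInt.toNNReal_strictMono (by norm_num)).comp
    MonoidWithZeroHom.ValueGroup₀.embedding_strictMono
  exists_val_nontrivial := ⟨HahnSeries.single 1 1, by simp, by
    have := LaurentSeries.valuation_single_zpow k 1
    rw [this]; rw [← WithZero.exp_zero, Ne, WithZero.exp_inj]; decide⟩

attribute [local instance] laurentRankOne

@[reducible] def laurentNormedField : NontriviallyNormedField k⸨X⸩ := Valued.toNontriviallyNormedField k⸨X⸩ (WithZero (Multiplicative ℤ))

attribute [local instance] laurentNormedField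

theorem laurent_isUltra : IsUltrametricDist k⸨X⸩ := inferInstance

theorem laurent_norm_le_one_iff (f : k⸨X⸩) : ‖f‖ ≤ 1 ↔ ∃ g : PowerSeries k, HahnSeries.ofPowerSeries ℤ k g = f := by
  rw [Valued.toNormedField.norm_le_one_iff, LaurentSeries.val_le_one_iff_eq_coe]

theorem laurent_norm_lt_one_iff (g : PowerSeries k) : ‖HahnSeries.ofPowerSeries ℤ k g‖ < 1 ↔ PowerSeries.constantCoeff g = 0 := by
  rw [Valued.toNormedField.norm_lt_one_iff]
  have h := LaurentSeries.intValuation_le_iff_coeff_lt_eq_zero k (d := 1) g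
  have h2 : Valued.v (HahnSeries.ofPowerSeries ℤ k g) < 1 ↔
      Valued.v (HahnSeries.ofPowerSeries ℤ k g) ≤ WithZero.exp (-((1 : ℕ) : ℤ)) := by
    rw [← WithZero.exp_zero]
    generalize Valued.v (HahnSeries.ofPowerSeries ℤ k g) = y
    induction y using WithZero.expRecOn with
    | zero => simp
    | exp n => rw [WithZero.exp_lt_exp, WithZero.exp_le_exp]; omega
  rw [h2, h]
  simp

/-- The uniformizer of `k((X))`. -/
def laurentX : k⸨X⸩ := HahnSeries.single 1 1

theorem laurent_norm_X_pos : 0 < ‖laurentX k‖ := by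
  rw [norm_pos_iff]
  simp [laurentX]

theorem laurent_norm_X_lt_one : ‖laurentX k‖ < 1 := by
  have : laurentX k = HahnSeries.ofPowerSeries ℤ k PowerSeries.X := by simp [laurentX]
  rw [this, laurent_norm_lt_one_iff]
  simp

theorem laurent_norm_ofPowerSeries_eq_one {g : PowerSeries k}
    (hg : PowerSeries.constantCoeff g ≠ 0) : ‖HahnSeries.ofPowerSeries ℤ k g‖ = 1 :=
  le_antisymm ((laurent_norm_le_one_iff k _).2 ⟨g, rfl⟩)
    (not_lt.1 fun h => hg ((laurent_norm_lt_one_iff k g).1 h))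

theorem laurent_norm_mem_zpowers {f : k⸨X⸩} (hf : f ≠ 0) :
    ∃ m : ℤ, ‖f‖ = ‖laurentX k‖ ^ m := by
  refine ⟨f.order, ?_⟩
  have h1 := LaurentSeries.single_order_mul_powerSeriesPart f
  have h2 : (HahnSeries.single f.order (1 : k) : k⸨X⸩) = laurentX k ^ f.order := by
    rw [laurentX, RatFunc.single_zpow]
  rw [← h1, norm_mul, h2, norm_zpow, laurent_norm_ofPowerSeries_eq_one, mul_one]
  · rw [← h2, h1]
  rw [← PowerSeries.coeff_zero_eq_constantCoeff_apply, LaurentSeries.powerSeriesPart_coeff]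
  simpa using hf

theorem laurent_exists_residue {f : k⸨X⸩} (hf : ‖f‖ ≤ 1) :
    ∃ c : k, ‖f - HahnSeries.C c‖ < 1 := by
  obtain ⟨g, rfl⟩ := (laurent_norm_le_one_iff k _).1 hf
  refine ⟨PowerSeries.constantCoeff g, ?_⟩
  have : HahnSeries.ofPowerSeries ℤ k g - HahnSeries.C (PowerSeries.constantCoeff g)
      = HahnSeries.ofPowerSeries ℤ k (g - PowerSeries.C (PowerSeries.constantCoeff g)) := by
    rw [map_sub, HahnSeries.ofPowerSeries_C]
  rw [this, laurent_norm_lt_one_iff]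
  simp

end LaurentNorm


section Spectral

variable (K : Type) [NontriviallyNormedField K] [IsUltrametricDist K] [CompleteSpace K]

/-- The unique extension of the norm of `K` to its algebraic closure. -/
def closureAbs : AbsoluteValue (AlgebraicClosure K) ℝ where
  toFun := spectralNorm K (AlgebraicClosure K)
  map_mul' := (spectralMulAlgNorm K (AlgebraicClosure K)).map_mul'
  nonneg' x := spectralNorm_nonneg x
  eq_zero' x := ⟨(spectralMulAlgNorm K (AlgebraicClosure K)).eq_zero_of_map_eq_zero' x,
    fun h => by rw [h]; exact spectralNorm_zero⟩
  add_le' := (spectralMulAlgNorm K (AlgebraicClosure K)).add_le'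

theorem closureAbs_nonarch : IsNonarchimedean (closureAbs K) := isNonarchimedean_spectralNorm

theorem closureAbs_algebraMap (x : K) : closureAbs K (algebraMap K _ x) = ‖x‖ :=
  spectralNorm_extends x

theorem closureAbs_equiv (σ : AlgebraicClosure K ≃ₐ[K] AlgebraicClosure K)
    (x : AlgebraicClosure K) : closureAbs K (σ x) = closureAbs K x :=
  (spectralNorm_eq_of_equiv σ x).symm

variable {K} {k : Type} [Field k] [IsAlgClosed k] (i : k →+* K)

theorem exists_residue (h1 : ∀ x : K, ‖x‖ ≤ 1 → ∃ c, ‖x - i c‖ < 1)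
    {x : AlgebraicClosure K} (hx : closureAbs K x ≤ 1) :
    ∃ c, closureAbs K (x - algebraMap K _ (i c)) < 1 := by
  have h_integral : IsIntegral K x := Algebra.IsIntegral.isIntegral x
  set P := minpoly K x with hP
  have hm : P.Monic := minpoly.monic h_integral
  have hc : ∀ n, ‖P.coeff n‖ ≤ 1 := (spectralValue_le_one_iff hm).1 hx
  choose c hcc using fun n => h1 _ (hc n)
  set p : Polynomial k := Polynomial.X ^ P.natDegree + ∑ n ∈ Finset.range P.natDegree, C (c n) * Polynomial.X ^ n with hp
  have hpm : p.Monic := by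
    rw [hp]
    apply Polynomial.monic_X_pow_add
    refine (Polynomial.degree_sum_le _ _).trans_lt ?_
    rw [Finset.sup_lt_iff (by exact WithBot.bot_lt_coe _)]
    intro n hn
    refine (Polynomial.degree_C_mul_X_pow_le _ _).trans_lt ?_
    exact_mod_cast Finset.mem_range.1 hn
  have hs : p.Splits := IsAlgClosed.splits p
  let f : k →+* AlgebraicClosure K := (algebraMap K _).comp i
  have e1 : p.eval₂ f x = (p.roots.map fun a => x - f a).prod := by
    conv_lhs => rw [hs.eq_prod_roots_of_monic hpm]
    rw [← Polynomial.coe_eval₂RingHom, map_multiset_prod, Multiset.map_map]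
    simp
  have e2 : p.eval₂ f x = ∑ n ∈ Finset.range P.natDegree, (- algebraMap K _ (P.coeff n - i (c n))) * x ^ n := by
    have := minpoly.aeval K x
    rw [← hP, Polynomial.aeval_eq_sum_range, Finset.sum_range_succ, hm.coeff_natDegree, one_smul] at this
    rw [hp]
    simp only [eval₂_add, eval₂_pow, eval₂_X, eval₂_finsetSum, eval₂_mul, eval₂_C]
    rw [eq_comm, ← sub_eq_zero, ← neg_eq_zero, ← this]
    simp only [Algebra.smul_def, f, RingHom.comp_apply, map_sub]
    simp only [neg_sub, sub_mul, Finset.sum_sub_distrib]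
    ring
  have e3 : closureAbs K (p.eval₂ f x) < 1 := by
    rw [e2]
    obtain hd | ⟨n, hn, hle⟩ : P.natDegree = 0 ∨ ∃ n ∈ Finset.range P.natDegree, closureAbs K (∑ n ∈ Finset.range P.natDegree, (- algebraMap K _ (P.coeff n - i (c n))) * x ^ n) ≤ closureAbs K ((- algebraMap K _ (P.coeff n - i (c n))) * x ^ n) := by
      rcases Nat.eq_zero_or_pos P.natDegree with h | h
      · exact Or.inl h
      · right
        exact (closureAbs_nonarch K).finset_image_add_of_nonempty _ ⟨0, Finset.mem_range.2 h⟩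
    · simp [hd]
    · refine hle.trans_lt ?_
      rw [map_mul, map_pow, AbsoluteValue.map_neg, closureAbs_algebraMap]
      calc _ ≤ ‖P.coeff n - i (c n)‖ * 1 := by
            gcongr
            exact pow_le_one₀ (AbsoluteValue.nonneg _ _) hx
        _ < 1 := by rw [mul_one]; exact hcc n
  by_contra! hcon
  rw [e1, map_multiset_prod, Multiset.map_map] at e3
  refine absurd e3 (not_lt.2 ?_)
  refine Multiset.one_le_prod ?_
  intro y hy
  obtain ⟨a, -, rfl⟩ := Multiset.mem_map.1 hy
  exact hcon a

theorem closureAbs_equiv_sub (h1 : ∀ x : K, ‖x‖ ≤ 1 → ∃ c, ‖x - i c‖ < 1)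
    (σ : AlgebraicClosure K ≃ₐ[K] AlgebraicClosure K)
    {x : AlgebraicClosure K} (hx : closureAbs K x ≤ 1) : closureAbs K (σ x - x) < 1 := by
  obtain ⟨c, hc⟩ := exists_residue i h1 hx
  set y := x - algebraMap K _ (i c)
  have : σ x - x = σ y + - y := by simp [y]
  rw [this]
  refine (closureAbs_nonarch K _ _).trans_lt ?_
  rw [closureAbs_equiv, AbsoluteValue.map_neg, max_self]
  exact hc

theorem closureAbs_orbit {x : AlgebraicClosure K} (hx : (minpoly K x).Separable) :
    closureAbs K x ^ (Set.range fun σ : AlgebraicClosure K ≃ₐ[K] AlgebraicClosure K => σ x).ncard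
      = ‖(minpoly K x).coeff 0‖ ∧
    0 < (Set.range fun σ : AlgebraicClosure K ≃ₐ[K] AlgebraicClosure K => σ x).ncard := by
  have h_integral : IsIntegral K x := Algebra.IsIntegral.isIntegral x
  have h1 : (Set.range fun σ : AlgebraicClosure K ≃ₐ[K] AlgebraicClosure K => σ x)
      = (minpoly K x).rootSet (AlgebraicClosure K) := by
    ext y
    rw [Polynomial.mem_rootSet_of_ne (minpoly.ne_zero h_integral)]
    change y ∈ MulAction.orbit (AlgebraicClosure K ≃ₐ[K] AlgebraicClosure K) x ↔ _
    rw [← Normal.minpoly_eq_iff_mem_orbit]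
    refine ⟨fun h => h ▸ minpoly.aeval K y, fun h => ?_⟩
    exact (minpoly.eq_of_irreducible_of_monic (minpoly.irreducible h_integral) h
      (minpoly.monic h_integral)).symm
  have h2 : (Set.range fun σ : AlgebraicClosure K ≃ₐ[K] AlgebraicClosure K => σ x).ncard = (minpoly K x).natDegree := by
    rw [h1, ← Nat.card_coe_set_eq, Nat.card_eq_fintype_card]
    exact Polynomial.card_rootSet_eq_natDegree hx (IsAlgClosed.splits _)
  have h3 := minpoly.natDegree_pos h_integral
  rw [h2]
  refine ⟨?_, h3⟩
  show spectralNorm K _ x ^ _ = _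
  rw [spectralNorm.spectralNorm_eq_norm_coeff_zero_rpow, ← Real.rpow_natCast, ← Real.rpow_mul (norm_nonneg _)]
  rw [one_div, inv_mul_cancel₀ (by exact_mod_cast h3.ne'), Real.rpow_one]
end Spectral

/-- A rank one valuation on the algebraic closure of `F` together with automorphisms in its
inertia group. -/
structure InertiaPlace (F : Type) [Field F] where
  ν : AbsoluteValue (AlgebraicClosure F) ℝ
  nonarch : IsNonarchimedean ν
  H : Set (AlgebraicClosure F ≃ₐ[F] AlgebraicClosure F)
  s : ℝ
  s_pos : 0 < s
  s_lt_one : s < 1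
  inv : ∀ σ ∈ H, ∀ x, ν (σ x) = ν x
  inert : ∀ σ ∈ H, ∀ x, ν x ≤ 1 → ν (σ x - x) < 1
  orbit : ∀ x, (minpoly F x).Separable → x ≠ 0 →
    0 < ((fun σ : AlgebraicClosure F ≃ₐ[F] AlgebraicClosure F => σ x) '' H).ncard ∧
    ∃ m : ℤ, ν x ^ ((fun σ : AlgebraicClosure F ≃ₐ[F] AlgebraicClosure F => σ x) '' H).ncard
      = s ^ m

section ExistsPlace

open scoped LaurentSeries

attribute [local instance] laurentRankOne laurentNormedField

theorem exists_inertiaPlace {F k : Type} [Field F] [Field k] [IsAlgClosed k] (j : F →+* k⸨X⸩) :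
    ∃ P : InertiaPlace F, (∀ f, P.ν (algebraMap F _ f) = ‖j f‖) ∧ P.s = ‖laurentX k‖ ∧
      ∀ f n, 0 < n → j f = laurentX k ^ n → ∃ y, P.ν y = P.s ∧ ∀ σ ∈ P.H, σ y = y := by
  have : IsUltrametricDist k⸨X⸩ := laurent_isUltra k
  let K := k⸨X⸩
  let Ω := AlgebraicClosure K
  let E := AlgebraicClosure F
  let : Algebra F Ω := ((algebraMap K Ω).comp j).toAlgebra
  let ι : E →ₐ[F] Ω := IsAlgClosed.lift
  let : Algebra E Ω := ι.toRingHom.toAlgebra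
  have : IsScalarTower F E Ω := IsScalarTower.of_algebraMap_eq fun x => (ι.commutes x).symm
  have hres : ∀ τ : Ω ≃ₐ[K] Ω, ∃ τ' : Ω ≃ₐ[F] Ω, ∀ x, τ' x = τ x := fun τ =>
    ⟨AlgEquiv.ofRingEquiv (f := τ.toRingEquiv) fun x => τ.commutes (j x), fun x => rfl⟩
  choose R hR using hres
  have hinj : Function.Injective ι := ι.toRingHom.injective
  have hι : ∀ τ x, ι ((R τ).restrictNormal E x) = τ (ι x) := fun τ x => by
    have := AlgEquiv.restrictNormal_commutes (R τ) E x
    rw [← hR]; exact this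
  let i : k →+* K := HahnSeries.C
  have h1 : ∀ x : K, ‖x‖ ≤ 1 → ∃ c, ‖x - i c‖ < 1 := fun x hx => laurent_exists_residue k hx
  refine ⟨⟨(closureAbs K).comp ι.injective, ?_, Set.range fun τ => (R τ).restrictNormal E,
    ‖laurentX k‖, laurent_norm_X_pos k, laurent_norm_X_lt_one k, ?_, ?_, ?_⟩, ?_, rfl, ?_⟩
  · intro x y
    change closureAbs K (ι (x + y)) ≤ max (closureAbs K (ι x)) (closureAbs K (ι y))
    rw [map_add]
    exact closureAbs_nonarch K _ _
  · rintro _ ⟨τ, rfl⟩ x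
    change closureAbs K (ι _) = closureAbs K (ι _)
    rw [hι, closureAbs_equiv]
  · rintro _ ⟨τ, rfl⟩ x hx
    change closureAbs K (ι _) < 1
    rw [map_sub, hι]
    exact closureAbs_equiv_sub i h1 τ hx
  · intro x hx hx0
    have hsep : (minpoly K (ι x)).Separable := by
      have h2 : ((minpoly F x).map j).Separable := hx.map
      refine h2.of_dvd (minpoly.dvd _ _ ?_)
      rw [aeval_def, eval₂_map]
      change eval₂ (algebraMap F Ω) _ _ = 0
      rw [← aeval_def, aeval_algHom_apply, minpoly.aeval, map_zero]
    have hset : (ι '' ((fun σ : E ≃ₐ[F] E => σ x) '' Set.range fun τ => (R τ).restrictNormal E))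
        = Set.range fun τ : Ω ≃ₐ[K] Ω => τ (ι x) := by
      rw [← Set.range_comp, ← Set.range_comp]
      congr 1
      funext τ
      exact hι τ x
    have hcard := Set.ncard_image_of_injective
      ((fun σ : E ≃ₐ[F] E => σ x) '' Set.range fun τ => (R τ).restrictNormal E) hinj
    have ho := closureAbs_orbit hsep
    rw [← hset, hcard] at ho
    refine ⟨ho.2, ?_⟩
    have hne : (minpoly K (ι x)).coeff 0 ≠ 0 :=
      minpoly.coeff_zero_ne_zero (Algebra.IsIntegral.isIntegral _)
        ((map_ne_zero_iff ι hinj).2 hx0)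
    obtain ⟨m, hm⟩ := laurent_norm_mem_zpowers k hne
    exact ⟨m, ho.1.trans hm⟩
  · intro f
    change closureAbs K (ι _) = _
    rw [ι.commutes]
    exact closureAbs_algebraMap K (j f)
  · intro f n hn hf
    obtain ⟨y, hy⟩ := IsAlgClosed.exists_pow_nat_eq (algebraMap F E f) hn
    have hy2 : ι y ^ n = algebraMap K Ω (laurentX k) ^ n := by
      rw [← map_pow, hy, ι.commutes, ← map_pow, ← hf]; rfl
    have hX0 : algebraMap K Ω (laurentX k) ≠ 0 := by
      rw [Ne, map_eq_zero, ← norm_eq_zero]; exact (laurent_norm_X_pos k).ne'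
    obtain ⟨c, hc⟩ : ∃ c : k, ι y = algebraMap K Ω (i c * laurentX k) := by
      set p : Polynomial k := X ^ n - C 1 with hp
      have hs : p.Splits := IsAlgClosed.splits p
      have hpm : p.Monic := monic_X_pow_sub_C 1 hn.ne'
      have e1 : p.eval₂ ((algebraMap K Ω).comp i) (ι y / algebraMap K Ω (laurentX k)) = 0 := by
        simp [hp, div_pow, hy2, hX0]
      rw [hs.eq_prod_roots_of_monic hpm, ← Polynomial.coe_eval₂RingHom, map_multiset_prod,
        Multiset.map_map, Multiset.prod_eq_zero_iff] at e1
      obtain ⟨a, -, ha⟩ := Multiset.mem_map.1 e1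
      refine ⟨a, ?_⟩
      simp [sub_eq_zero] at ha
      rw [map_mul, ← ha, div_mul_cancel₀ _ hX0]
    refine ⟨y, ?_, ?_⟩
    · have : (closureAbs K (ι y)) ^ n = ‖laurentX k‖ ^ n := by
        rw [← map_pow, hy2, map_pow, closureAbs_algebraMap]
      exact (pow_left_inj₀ (AbsoluteValue.nonneg _ _) (norm_nonneg _) hn.ne').1 this
    · rintro _ ⟨τ, rfl⟩
      apply hinj
      change ι ((R τ).restrictNormal E y) = _
      rw [hι, hc, τ.commutes]

end ExistsPlace

section
open scoped LaurentSeries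
attribute [local instance] laurentRankOne laurentNormedField

variable {Fq : Type} [Field Fq]

theorem exists_finitePlace [Finite Fq] {l : Polynomial Fq} (hl : Irreducible l) {e : ℕ} (he : 0 < e) :
    ∃ P : InertiaPlace (RatFunc Fq),
      (∀ b : Polynomial Fq, P.ν (algebraMap _ _ b) ≤ 1) ∧
      (∀ b : Polynomial Fq, ¬ l ∣ b → P.ν (algebraMap _ _ b) = 1) ∧
      P.ν (algebraMap _ _ l) = P.s ^ e ∧
      (l = X → ∃ y, P.ν y = P.s ∧ ∀ σ ∈ P.H, σ y = y) := by
  let k := AlgebraicClosure Fq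
  obtain ⟨θ, hθ⟩ : ∃ θ : k, aeval θ l = 0 :=
    IsAlgClosed.exists_aeval_eq_zero k l (degree_pos_of_irreducible hl).ne'
  let S : PowerSeries k := PowerSeries.X
  let c : Fq →+* PowerSeries k := PowerSeries.C.comp (algebraMap Fq k)
  let J : Polynomial Fq →+* PowerSeries k := eval₂RingHom c (PowerSeries.C θ + S ^ e)
  have hJ0 : ∀ b, PowerSeries.constantCoeff (J b) = aeval θ b := by
    intro b
    have : (PowerSeries.constantCoeff (R := k)).comp J = (aeval θ : Polynomial Fq →ₐ[Fq] k).toRingHom := by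
      ext x
      · simp [J, c]
      · simp [J, S, he.ne']
    exact DFunLike.congr_fun this b
  have hdvd : ∀ b, ¬ l ∣ b → aeval θ b ≠ 0 := by
    intro b hb h0
    obtain ⟨u, v, huv⟩ := (hl.coprime_iff_not_dvd.2 hb)
    have := congrArg (aeval θ) huv
    simp [hθ, h0] at this
  have hJl : ∃ w, J l = S ^ e * w ∧ PowerSeries.constantCoeff w ≠ 0 := by
    obtain ⟨w, hw⟩ := Polynomial.binomExpansion (l.map c) (PowerSeries.C θ) (S ^ e)
    refine ⟨PowerSeries.C (aeval θ (derivative l)) + w * S ^ e, ?_, ?_⟩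
    · have h1 : ∀ b : Polynomial Fq, (b.map c).eval (PowerSeries.C θ) = PowerSeries.C (aeval θ b) := by
        intro b
        rw [aeval_def, eval_map, ← Polynomial.hom_eval₂]
      have h2 : J l = (l.map c).eval (PowerSeries.C θ + S ^ e) := by
        rw [eval_map]; rfl
      rw [h2, hw, derivative_map, h1, h1, hθ, map_zero]
      ring
    · have hsep : l.Separable := PerfectField.separable_of_irreducible hl
      have : aeval θ (derivative l) ≠ 0 := by
        apply hsep.aeval_derivative_ne_zero hθ
      simpa [S, he.ne'] using this
  obtain ⟨w, hw, hw0⟩ := hJl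
  have hS0 : S ≠ 0 := PowerSeries.X_ne_zero
  have hne : ∀ b, b ≠ 0 → J b ≠ 0 := by
    intro b hb
    obtain ⟨n, b', hb', rfl⟩ := WfDvdMonoid.max_power_factor hb hl
    rw [map_mul, map_pow, hw]
    refine mul_ne_zero (pow_ne_zero _ (mul_ne_zero (pow_ne_zero _ hS0) ?_)) ?_
    · rintro rfl; simp at hw0
    · intro h
      have := hJ0 b'
      rw [h, map_zero] at this
      exact hdvd b' hb' this.symm
  let J' : Polynomial Fq →+* k⸨X⸩ := (HahnSeries.ofPowerSeries ℤ k).comp J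
  have hinj : Function.Injective J' := by
    rw [injective_iff_map_eq_zero]
    intro b hb
    by_contra h
    exact hne b h (HahnSeries.ofPowerSeries_injective (hb.trans (map_zero _).symm))
  let j : RatFunc Fq →+* k⸨X⸩ := IsFractionRing.lift hinj
  have hj : ∀ b : Polynomial Fq, j (algebraMap _ _ b) = J' b := fun b => IsFractionRing.lift_algebraMap hinj b
  obtain ⟨P, hP1, hP2, hP3⟩ := exists_inertiaPlace j
  have hP : ∀ b : Polynomial Fq, P.ν (algebraMap _ _ b) = ‖J' b‖ := by
    intro b
    rw [IsScalarTower.algebraMap_apply (Polynomial Fq) (RatFunc Fq), hP1, hj]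
  refine ⟨P, ?_, ?_, ?_, ?_⟩
  · intro b
    rw [hP]
    exact (laurent_norm_le_one_iff k _).2 ⟨_, rfl⟩
  · intro b hb
    rw [hP]
    apply laurent_norm_ofPowerSeries_eq_one
    rw [hJ0]; exact hdvd b hb
  · rw [hP, hP2]
    change ‖HahnSeries.ofPowerSeries ℤ k (J l)‖ = _
    rw [hw, map_mul, norm_mul, laurent_norm_ofPowerSeries_eq_one k hw0, map_pow, norm_pow, mul_one]
    simp [S, laurentX]
  · intro hX
    have hθ0 : θ = 0 := by simpa [hX] using hθ
    refine hP3 (algebraMap (Polynomial Fq) (RatFunc Fq) X) e he ?_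
    rw [hj]
    change HahnSeries.ofPowerSeries ℤ k (J X) = _
    simp [J, S, hθ0, laurentX]

theorem exists_infinitePlace :
    ∃ P : InertiaPlace (RatFunc Fq), ∃ R : ℝ, 1 < R ∧
      ∀ b : Polynomial Fq, b ≠ 0 → P.ν (algebraMap _ _ b) = R ^ b.natDegree := by
  let k := AlgebraicClosure Fq
  let c : Fq →+* k⸨X⸩ := HahnSeries.C.comp (algebraMap Fq k)
  let J : Polynomial Fq →+* k⸨X⸩ := eval₂RingHom c (laurentX k)⁻¹
  have hX := laurent_norm_X_pos k
  have hX1 := laurent_norm_X_lt_one k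
  have hX0 : laurentX k ≠ 0 := norm_pos_iff.1 hX
  have hnorm : ∀ b : Polynomial Fq, b ≠ 0 → ‖J b‖ = ‖laurentX k‖⁻¹ ^ b.natDegree := by
    intro b hb
    let : Invertible (laurentX k)⁻¹ := invertibleOfNonzero (inv_ne_zero hX0)
    have h1 := eval₂_reverse_mul_pow c (laurentX k)⁻¹ b
    rw [invOf_eq_inv, inv_inv] at h1
    change ‖eval₂ c (laurentX k)⁻¹ b‖ = _
    have h2 : eval₂ c (laurentX k) b.reverse
        = HahnSeries.ofPowerSeries ℤ k ((b.reverse.map (algebraMap Fq k) : Polynomial k) : PowerSeries k) := by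
      generalize b.reverse = d
      induction d using Polynomial.induction_on' with
      | add p q hp hq => simp [eval₂_add, hp, hq]
      | monomial n a =>
        rw [eval₂_monomial, map_monomial, ← C_mul_X_pow_eq_monomial]
        simp [c, laurentX]
    rw [← h1, h2, norm_mul, norm_pow, norm_inv, laurent_norm_ofPowerSeries_eq_one, one_mul]
    rw [← PowerSeries.coeff_zero_eq_constantCoeff_apply, Polynomial.coeff_coe, coeff_map,
      coeff_zero_reverse]
    simpa using hb
  have hinj : Function.Injective J := by
    rw [injective_iff_map_eq_zero]
    intro b hb
    by_contra h
    have := hnorm b h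
    rw [hb, norm_zero] at this
    exact (pow_pos (inv_pos.2 hX) _).ne this
  let j : RatFunc Fq →+* k⸨X⸩ := IsFractionRing.lift hinj
  obtain ⟨P, hP1, -⟩ := exists_inertiaPlace j
  refine ⟨P, ‖laurentX k‖⁻¹, (one_lt_inv₀ hX).2 hX1, fun b hb => ?_⟩
  rw [IsScalarTower.algebraMap_apply (Polynomial Fq) (RatFunc Fq), hP1, ← hnorm b hb]
  exact congrArg norm (IsFractionRing.lift_algebraMap hinj b)
end

section TorsionPoly

variable {Fq : Type} [Field Fq]

/-- The polynomial `T X + X^{q^{r-1}} + T^{q-1} X^{q^r}` over `A = 𝔽_q[T]`. -/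
def drinfeldT (Fq : Type) [Field Fq] (q r : ℕ) : Polynomial (Polynomial Fq) :=
  C X * X + X ^ q ^ (r - 1) + C (X ^ (q - 1)) * X ^ q ^ r

/-- The iterates of `drinfeldT`. -/
def drinfeldIter (Fq : Type) [Field Fq] (q r : ℕ) : ℕ → Polynomial (Polynomial Fq)
  | 0 => X
  | i + 1 => (drinfeldT Fq q r).comp (drinfeldIter Fq q r i)

/-- The polynomial over `A` whose evaluation is `φ_a`. -/
def torsionPoly (q r : ℕ) (a : Polynomial Fq) : Polynomial (Polynomial Fq) :=
  ∑ i ∈ Finset.range (a.natDegree + 1), C (C (a.coeff i)) * drinfeldIter Fq q r i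

variable {q r : ℕ}

theorem aeval_drinfeldT {φ : Polynomial Fq →+* AddMonoid.End (Kbar Fq)}
    (hφ : IsDrinfeldPhi Fq q r φ) (x : Kbar Fq) : aeval x (drinfeldT Fq q r) = φ X x := by
  rw [hφ.2]
  simp [drinfeldT, IsScalarTower.algebraMap_apply (Polynomial Fq) (RatFunc Fq) (Kbar Fq)]

theorem aeval_drinfeldIter {φ : Polynomial Fq →+* AddMonoid.End (Kbar Fq)}
    (hφ : IsDrinfeldPhi Fq q r φ) (i : ℕ) (x : Kbar Fq) :
    aeval x (drinfeldIter Fq q r i) = φ (X ^ i) x := by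
  induction i with
  | zero => simp [drinfeldIter]
  | succ i ih => rw [drinfeldIter, aeval_comp, ih, aeval_drinfeldT hφ, pow_succ', map_mul]; rfl

theorem phi_C {φ : Polynomial Fq →+* AddMonoid.End (Kbar Fq)}
    (hφ : IsDrinfeldPhi Fq q r φ) (c : Fq) (x : Kbar Fq) :
    φ (C c) x = algebraMap (Polynomial Fq) (Kbar Fq) (C c) * x := by
  rw [hφ.1, IsScalarTower.algebraMap_apply (Polynomial Fq) (RatFunc Fq) (Kbar Fq)]
  simp

theorem phi_X {φ : Polynomial Fq →+* AddMonoid.End (Kbar Fq)}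
    (hφ : IsDrinfeldPhi Fq q r φ) (x : Kbar Fq) :
    φ X x = algebraMap (Polynomial Fq) (Kbar Fq) X * x + x ^ q ^ (r - 1) +
      algebraMap (Polynomial Fq) (Kbar Fq) X ^ (q - 1) * x ^ q ^ r := by
  rw [hφ.2, IsScalarTower.algebraMap_apply (Polynomial Fq) (RatFunc Fq) (Kbar Fq)]
  simp

theorem aeval_torsionPoly {φ : Polynomial Fq →+* AddMonoid.End (Kbar Fq)}
    (hφ : IsDrinfeldPhi Fq q r φ) (a : Polynomial Fq) (x : Kbar Fq) :
    aeval x (torsionPoly q r a) = φ a x := by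
  conv_rhs => rw [a.as_sum_range_C_mul_X_pow, map_sum]
  rw [torsionPoly, map_sum]
  refine Eq.trans ?_ (AddMonoidHom.finsetSum_apply _ _ x).symm
  refine Finset.sum_congr rfl fun i _ => ?_
  rw [map_mul, map_mul, aeval_drinfeldIter hφ, aeval_C, ← phi_C hφ]
  rfl

theorem natDegree_drinfeldT (hq : 1 < q) (hr : 0 < r) :
    (drinfeldT Fq q r).natDegree = q ^ r ∧ (drinfeldT Fq q r).leadingCoeff = X ^ (q - 1) := by
  have h1 : q ^ (r - 1) < q ^ r := Nat.pow_lt_pow_right hq (by omega)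
  have h0 : 1 < q ^ r := Nat.one_lt_pow hr.ne' hq
  have hX : (X : Polynomial Fq) ^ (q - 1) ≠ 0 := pow_ne_zero _ X_ne_zero
  have h2 : (C X * X + X ^ q ^ (r - 1) : Polynomial (Polynomial Fq)).natDegree
      < (C (X ^ (q - 1)) * X ^ q ^ r : Polynomial (Polynomial Fq)).natDegree := by
    rw [natDegree_C_mul_X_pow _ _ hX]
    refine (natDegree_add_le _ _).trans_lt (max_lt ?_ ?_)
    · exact (natDegree_C_mul_le _ _).trans_lt (by rwa [natDegree_X])
    · rwa [natDegree_X_pow]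
  constructor
  · rw [drinfeldT, natDegree_add_eq_right_of_natDegree_lt h2, natDegree_C_mul_X_pow _ _ hX]
  · rw [drinfeldT, leadingCoeff_add_of_degree_lt (degree_lt_degree h2), leadingCoeff_C_mul_X_pow]

theorem natDegree_drinfeldIter (hq : 1 < q) (hr : 0 < r) (i : ℕ) :
    (drinfeldIter Fq q r i).natDegree = (q ^ r) ^ i ∧
      ∃ m, (drinfeldIter Fq q r i).leadingCoeff = X ^ m := by
  induction i with
  | zero => exact ⟨by simp [drinfeldIter], 0, by simp [drinfeldIter]⟩
  | succ i ih =>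
    obtain ⟨h1, m, h2⟩ := ih
    obtain ⟨h3, h4⟩ := natDegree_drinfeldT (Fq := Fq) hq hr
    have : 0 < q := by omega
    refine ⟨by rw [drinfeldIter, natDegree_comp, h1, h3, pow_succ'], q - 1 + m * q ^ r, ?_⟩
    rw [drinfeldIter, leadingCoeff_comp (by rw [h1]; positivity), h2, h3, h4, ← pow_mul, ← pow_add]

theorem natDegree_torsionPoly (hq : 1 < q) (hr : 0 < r) {a : Polynomial Fq} (ha : a ≠ 0) :
    (torsionPoly q r a).natDegree = q ^ (r * a.natDegree) ∧
      ∃ m, (torsionPoly q r a).leadingCoeff = C a.leadingCoeff * X ^ m := by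
  have hc : (C (a.coeff a.natDegree) : Polynomial Fq) ≠ 0 := by simpa using ha
  obtain ⟨h1, m, h2⟩ := natDegree_drinfeldIter (Fq := Fq) hq hr a.natDegree
  have h3 : (C (C (a.coeff a.natDegree)) * drinfeldIter Fq q r a.natDegree).natDegree
      = q ^ (r * a.natDegree) := by
    rw [natDegree_C_mul hc, h1, pow_mul]
  have h4 : (∑ i ∈ Finset.range a.natDegree, C (C (a.coeff i)) * drinfeldIter Fq q r i).natDegree
      < (C (C (a.coeff a.natDegree)) * drinfeldIter Fq q r a.natDegree).natDegree := by
    rw [h3]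
    refine Finset.sum_induction _ (fun p : Polynomial (Polynomial Fq) => p.natDegree < q ^ (r * a.natDegree)) ?_ ?_ ?_
    · exact fun p q hp hq => (natDegree_add_le _ _).trans_lt (max_lt hp hq)
    · rw [natDegree_zero]; positivity
    · intro i hi
      refine (natDegree_C_mul_le _ _).trans_lt ?_
      rw [(natDegree_drinfeldIter (Fq := Fq) hq hr i).1, ← pow_mul]
      exact Nat.pow_lt_pow_right hq (Nat.mul_lt_mul_of_pos_left (Finset.mem_range.1 hi) hr)
  rw [torsionPoly, Finset.sum_range_succ]
  refine ⟨by rw [natDegree_add_eq_right_of_natDegree_lt h4, h3], m, ?_⟩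
  rw [leadingCoeff_add_of_degree_lt (degree_lt_degree h4), leadingCoeff_mul, leadingCoeff_C, h2,
    leadingCoeff]

theorem map_drinfeldIter (hq : 1 < q) (i : ℕ) :
    (drinfeldIter Fq q r i).map (evalRingHom 0) = X ^ (q ^ (r - 1)) ^ i := by
  induction i with
  | zero => simp [drinfeldIter]
  | succ i ih =>
    rw [drinfeldIter, map_comp, ih]
    have : q - 1 ≠ 0 := by omega
    simp [drinfeldT, this, ← pow_mul, pow_succ]

theorem map_torsionPoly (hq : 1 < q) (hr : 1 < r) {a : Polynomial Fq} (ha : a ≠ 0) :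
    ((torsionPoly q r a).map (evalRingHom 0)).natDegree = q ^ ((r - 1) * a.natDegree) := by
  have hQ : 1 < q ^ (r - 1) := Nat.one_lt_pow (by omega) hq
  have h1 : (torsionPoly q r a).map (evalRingHom 0)
      = ∑ i ∈ Finset.range (a.natDegree + 1), C (a.coeff i) * X ^ (q ^ (r - 1)) ^ i := by
    rw [torsionPoly, Polynomial.map_sum]
    refine Finset.sum_congr rfl fun i _ => ?_
    rw [Polynomial.map_mul, map_drinfeldIter hq]
    simp
  have hc : a.coeff a.natDegree ≠ 0 := by simpa using ha
  rw [h1, Finset.sum_range_succ, natDegree_add_eq_right_of_natDegree_lt,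
    natDegree_C_mul_X_pow _ _ hc, pow_mul]
  rw [natDegree_C_mul_X_pow _ _ hc]
  refine Finset.sum_induction _
    (fun p : Polynomial Fq => p.natDegree < (q ^ (r - 1)) ^ a.natDegree) ?_ ?_ ?_
  · exact fun p q hp hq => (natDegree_add_le _ _).trans_lt (max_lt hp hq)
  · rw [natDegree_zero]; positivity
  · intro i hi
    exact (natDegree_C_mul_X_pow_le _ _).trans_lt
      (Nat.pow_lt_pow_right hQ (Finset.mem_range.1 hi))

theorem coeff_zero_torsionPoly (hq : 1 < q) (a : Polynomial Fq) :
    (torsionPoly q r a).coeff 0 = 0 := by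
  have h : ∀ i, (drinfeldIter Fq q r i).eval 0 = 0 := by
    intro i
    have h0 : q ≠ 0 := by omega
    induction i with
    | zero => simp [drinfeldIter]
    | succ i ih => rw [drinfeldIter, eval_comp, ih]; simp [drinfeldT, h0]
  rw [coeff_zero_eq_eval_zero, torsionPoly, eval_finsetSum]
  simp [h]

theorem derivative_torsionPoly [Fintype Fq] (hq : Fintype.card Fq = q) (hr : 1 < r)
    (a : Polynomial Fq) : derivative (torsionPoly q r a) = C a := by
  have hq0 : ((q : ℕ) : Polynomial (Polynomial Fq)) = 0 := by
    rw [← hq, ← map_natCast (C.comp C : Fq →+* Polynomial (Polynomial Fq)),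
      FiniteField.cast_card_eq_zero, map_zero]
  have hT : derivative (drinfeldT Fq q r) = C X := by
    have : r - 1 ≠ 0 := by omega
    have : r ≠ 0 := by omega
    have h1 : ((q ^ (r - 1) : ℕ) : Polynomial (Polynomial Fq)) = 0 := by
      rw [Nat.cast_pow, hq0, zero_pow (by omega)]
    have h2 : ((q ^ r : ℕ) : Polynomial (Polynomial Fq)) = 0 := by
      rw [Nat.cast_pow, hq0, zero_pow (by omega)]
    rw [drinfeldT, derivative_add, derivative_add, derivative_C_mul, derivative_C_mul,
      derivative_X, derivative_X_pow, derivative_X_pow, C_eq_natCast, C_eq_natCast, h1, h2]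
    simp
  have hI : ∀ i, derivative (drinfeldIter Fq q r i) = C (X ^ i) := by
    intro i
    induction i with
    | zero => simp [drinfeldIter]
    | succ i ih =>
      rw [drinfeldIter, derivative_comp, ih, hT, C_comp, ← C_mul, pow_succ]
  conv_rhs => rw [a.as_sum_range_C_mul_X_pow]
  rw [torsionPoly, derivative_sum, map_sum]
  refine Finset.sum_congr rfl fun i _ => ?_
  rw [derivative_C_mul, hI, ← C_mul]

theorem coeff_one_torsionPoly [Fintype Fq] (hq : Fintype.card Fq = q) (hr : 1 < r)
    (a : Polynomial Fq) : (torsionPoly q r a).coeff 1 = a := by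
  have := coeff_derivative (torsionPoly q r a) 0
  rw [derivative_torsionPoly hq hr] at this
  simpa using this.symm

end TorsionPoly

section Nonarch

variable {E : Type*} [Field E] {ν : AbsoluteValue E ℝ}

theorem nonarch_sub_le (hν : IsNonarchimedean ν) (x y : E) : ν (x - y) ≤ max (ν x) (ν y) := by
  simpa [sub_eq_add_neg] using hν x (-y)

theorem nonarch_sum_le (hν : IsNonarchimedean ν) {ι : Type*} {s : Finset ι} {f : ι → E} {B : ℝ}
    (hB : 0 ≤ B) (h : ∀ i ∈ s, ν (f i) ≤ B) : ν (∑ i ∈ s, f i) ≤ B := by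
  refine Finset.sum_induction f (fun x => ν x ≤ B) (fun x y hx hy => (hν x y).trans (max_le hx hy))
    (by simpa using hB) h

/-- A dominating term determines the absolute value of `P(x)`. -/
theorem nonarch_eval_eq (hν : IsNonarchimedean ν) {P : Polynomial E} {x : E} {k : ℕ}
    (hk : P.coeff k ≠ 0)
    (h : ∀ i, i ≠ k → P.coeff i ≠ 0 → ν (P.coeff i) * ν x ^ i < ν (P.coeff k) * ν x ^ k) :
    ν (P.eval x) = ν (P.coeff k) * ν x ^ k := by
  rw [eval_eq_sum, Polynomial.sum_def]
  have := hν.apply_sum_eq_of_lt (fun a => (ν.map_neg a).symm) (s := P.support)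
    (l := fun i => P.coeff i * x ^ i) (k := k) (by simpa using hk) (by
      intro j hj hjk
      simpa using h j hjk (by simpa using hj))
  simpa using this

theorem nonarch_eval_le_one (hν : IsNonarchimedean ν) {P : Polynomial E} {x : E}
    (hP : ∀ i, ν (P.coeff i) ≤ 1) (hx : ν x ≤ 1) : ν (P.eval x) ≤ 1 := by
  rw [eval_eq_sum, Polynomial.sum_def]
  refine nonarch_sum_le hν zero_le_one fun i _ => ?_
  rw [map_mul, map_pow]
  exact mul_le_one₀ (hP i) (by positivity) (pow_le_one₀ (by positivity) hx)

/-- Roots of an integral polynomial with unit leading coefficient are integral. -/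
theorem nonarch_root_le_one (hν : IsNonarchimedean ν) {P : Polynomial E} {x : E}
    (hP : ∀ i, ν (P.coeff i) ≤ 1) (hl : ν P.leadingCoeff = 1) (hx : P.eval x = 0) : ν x ≤ 1 := by
  by_contra! h1
  have hl0 : P.coeff P.natDegree ≠ 0 := fun h => by
    rw [leadingCoeff, h, map_zero] at hl; exact zero_ne_one hl
  have := nonarch_eval_eq hν (x := x) hl0 fun i hi hi0 => by
    have hlt : i < P.natDegree := lt_of_le_of_ne (le_natDegree_of_ne_zero hi0) hi
    calc ν (P.coeff i) * ν x ^ i ≤ 1 * ν x ^ i := by gcongr; exact hP i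
      _ < 1 * ν x ^ P.natDegree := by rw [one_mul, one_mul]; exact pow_lt_pow_right₀ h1 hlt
      _ = _ := by rw [← hl]; rfl
  rw [hx, map_zero, ← leadingCoeff, hl, one_mul] at this
  exact absurd this (by positivity)

/-- Small roots of an integral polynomial with vanishing constant term and unit linear
coefficient vanish. -/
theorem nonarch_small_root (hν : IsNonarchimedean ν) {P : Polynomial E} {x : E}
    (hP : ∀ i, ν (P.coeff i) ≤ 1) (h0 : P.coeff 0 = 0) (h1 : ν (P.coeff 1) = 1)
    (hx : P.eval x = 0) (hx1 : ν x < 1) : x = 0 := by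
  by_contra hne
  have hpos : 0 < ν x := ν.pos hne
  have := nonarch_eval_eq hν (P := P) (x := x) (k := 1)
    (fun h => by rw [h, map_zero] at h1; exact zero_ne_one h1) fun i hi hi0 => by
      have hi2 : 1 < i := by
        rcases i with _ | _ | i
        · exact absurd h0 hi0
        · exact absurd rfl hi
        · omega
      calc ν (P.coeff i) * ν x ^ i ≤ 1 * ν x ^ i := by gcongr; exact hP i
        _ < 1 * ν x ^ 1 := by
          rw [one_mul, one_mul]; exact pow_lt_pow_right_of_lt_one₀ hpos hx1 hi2
        _ = _ := by rw [h1]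
  rw [hx, map_zero, h1, one_mul, pow_one] at this
  exact hpos.ne this

/-- The absolute value of the small roots of a polynomial whose Newton polygon starts with the
segment between the indices `1` and `J`. -/
theorem nonarch_small_root_pow (hν : IsNonarchimedean ν) {P : Polynomial E} {x : E} {J : ℕ}
    (hJ : 1 < J) (hP : ∀ i, ν (P.coeff i) ≤ 1) (h0 : P.coeff 0 = 0) (hPJ : ν (P.coeff J) = 1)
    (h1 : P.coeff 1 ≠ 0) (hi : ∀ i, i < J → ν (P.coeff i) ≤ ν (P.coeff 1))
    (hx : P.eval x = 0) (hx1 : ν x < 1) (hne : x ≠ 0) : ν x ^ (J - 1) = ν (P.coeff 1) := by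
  have hpos : 0 < ν x := ν.pos hne
  have hc : 0 < ν (P.coeff 1) := ν.pos h1
  have key : ν x ^ J = ν x ^ (J - 1) * ν x := by
    rw [← pow_succ]; congr 1; omega
  have hJ0 : P.coeff J ≠ 0 := fun h => by rw [h, map_zero] at hPJ; exact zero_ne_one hPJ
  have low : ∀ i, i ≠ 1 → i < J → P.coeff i ≠ 0 →
      ν (P.coeff i) * ν x ^ i < ν (P.coeff 1) * ν x := fun i hi1 hiJ hi0 => by
    have hi2 : 1 < i := by
      rcases i with _ | _ | i
      · exact absurd h0 hi0
      · exact absurd rfl hi1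
      · omega
    calc ν (P.coeff i) * ν x ^ i ≤ ν (P.coeff 1) * ν x ^ i := by gcongr; exact hi i hiJ
      _ < ν (P.coeff 1) * ν x := by
        have := pow_lt_pow_right_of_lt_one₀ hpos hx1 hi2
        rw [pow_one] at this
        gcongr
  have high : ∀ i, J < i → ν (P.coeff i) * ν x ^ i < ν x ^ J := fun i hJi => by
    calc ν (P.coeff i) * ν x ^ i ≤ 1 * ν x ^ i := by gcongr; exact hP i
      _ < ν x ^ J := by rw [one_mul]; exact pow_lt_pow_right_of_lt_one₀ hpos hx1 hJi
  rcases lt_trichotomy (ν x ^ (J - 1)) (ν (P.coeff 1)) with h | h | h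
  · exfalso
    have h' : ν x ^ J < ν (P.coeff 1) * ν x := by rw [key]; gcongr
    have := nonarch_eval_eq hν (x := x) (k := 1) h1 fun i hi1 hi0 => by
      rw [pow_one]
      rcases lt_trichotomy i J with h2 | rfl | h2
      · exact low i hi1 h2 hi0
      · rwa [hPJ, one_mul]
      · exact (high i h2).trans h'
    rw [hx, map_zero] at this
    exact (by positivity : (0 : ℝ) < ν (P.coeff 1) * ν x ^ 1).ne this
  · exact h
  · exfalso
    have h' : ν (P.coeff 1) * ν x < ν x ^ J := by rw [key]; gcongr
    have := nonarch_eval_eq hν (x := x) (k := J) hJ0 fun i hiJ hi0 => by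
      rw [hPJ, one_mul]
      rcases lt_or_gt_of_ne hiJ with h2 | h2
      · by_cases hi1 : i = 1
        · subst hi1; simpa using h'
        · exact (low i hi1 h2 hi0).trans h'
      · exact high i h2
    rw [hx, map_zero, hPJ, one_mul] at this
    exact (pow_pos hpos J).ne this

/-- The ring of integers of a nonarchimedean absolute value. -/
def integers (hν : IsNonarchimedean ν) : Subring E where
  carrier := {x | ν x ≤ 1}
  mul_mem' {x y} hx hy := by
    change ν (x * y) ≤ 1
    rw [map_mul]; exact mul_le_one₀ hx (by positivity) hy
  one_mem' := by simp
  add_mem' {x y} hx hy := (hν x y).trans (max_le hx hy)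
  zero_mem' := by simp
  neg_mem' {x} hx := by simpa using hx

/-- The maximal ideal of the ring of integers. -/
def integersIdeal (hν : IsNonarchimedean ν) : Ideal (integers hν) where
  carrier := {x | ν (x : E) < 1}
  add_mem' {x y} hx hy := (hν x y).trans_lt (max_lt hx hy)
  zero_mem' := by simp
  smul_mem' c x hx := by
    change ν ((c : E) * x) < 1
    rw [map_mul]
    exact mul_lt_one_of_nonneg_of_lt_one_right c.2 (by positivity) hx

theorem mem_integersIdeal (hν : IsNonarchimedean ν) {x : integers hν} :
    x ∈ integersIdeal hν ↔ ν (x : E) < 1 := Iff.rfl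

instance (hν : IsNonarchimedean ν) : (integersIdeal hν).IsPrime where
  ne_top' h := by
    have : (1 : integers hν) ∈ integersIdeal hν := h ▸ Submodule.mem_top
    simp [mem_integersIdeal] at this
  mem_or_mem' {x y} hxy := by
    by_contra! h
    simp only [mem_integersIdeal, not_lt, Subring.coe_mul, map_mul] at h hxy
    have hx : ν (x : E) = 1 := le_antisymm x.2 h.1
    have hy : ν (y : E) = 1 := le_antisymm y.2 h.2
    simp [hx, hy] at hxy

/-- Reduction bounds on the number of integral roots and of small roots. -/
theorem nonarch_card_roots_le (hν : IsNonarchimedean ν) {P : Polynomial E}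
    (hP : ∀ i, ν (P.coeff i) ≤ 1) {k : ℕ} (hk : ν (P.coeff k) = 1) {W : Finset E}
    (hW : ∀ w ∈ W, P.eval w = 0) :
    ((∀ w ∈ W, ν w ≤ 1) → (∀ i, k < i → ν (P.coeff i) < 1) → W.card ≤ k) ∧
      ((∀ w ∈ W, ν w < 1) → W.card ≤ k) := by
  have hP0 : P ≠ 0 := fun h => by simp [h] at hk
  have main : ∀ hW1 : ∀ w ∈ W, ν w ≤ 1, ∃ R : Polynomial (integers hν ⧸ integersIdeal hν),
      ∃ S : Polynomial (integers hν), (∀ i, ((S.coeff i : integers hν) : E) = P.coeff i) ∧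
      S.map (Ideal.Quotient.mk _) =
        (∏ w ∈ W.attach, (X - C (Ideal.Quotient.mk _ (⟨w, hW1 w w.2⟩ : integers hν)))) * R := by
    intro hW1
    have hlift : P ∈ lifts (integers hν).subtype := by
      rw [lifts_iff_coeff_lifts]
      exact fun i => ⟨⟨P.coeff i, hP i⟩, rfl⟩
    obtain ⟨S, hS⟩ := (mem_lifts P).1 hlift
    have hScoeff : ∀ i, ((S.coeff i : integers hν) : E) = P.coeff i := by
      intro i; rw [← hS, coeff_map]; rfl
    have hS0 : S ≠ 0 := by rintro rfl; simp at hS; exact hP0 hS.symm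
    let m : Multiset (integers hν) := (W.attach.map
      ⟨fun w : {w // w ∈ W} => (⟨w, hW1 w w.2⟩ : integers hν), fun a b h => by
        exact Subtype.ext (congrArg (fun y : integers hν => (y : E)) h)⟩).val
    have hm : (m.map (fun a => X - C a)).prod ∣ S := by
      rw [Multiset.prod_X_sub_C_dvd_iff_le_roots hS0, Multiset.le_iff_subset (Finset.nodup _)]
      intro a ha
      simp only [Finset.map_val, Multiset.mem_map] at ha
      obtain ⟨w, -, rfl⟩ := ha
      rw [mem_roots hS0, IsRoot, ← Subtype.coe_inj]
      have h3 := hW w w.2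
      rw [← hS, eval_map] at h3
      change (integers hν).subtype (S.eval _) = _
      rw [← eval₂_at_apply]
      exact h3
    obtain ⟨R, hR⟩ := hm
    refine ⟨R.map (Ideal.Quotient.mk _), S, hScoeff, ?_⟩
    conv_lhs => rw [hR]
    rw [Polynomial.map_mul]
    congr 1
    simp only [m, Finset.map_val, Multiset.map_map]
    change Polynomial.map _ (∏ w ∈ W.attach, (X - C (⟨w, hW1 w w.2⟩ : integers hν))) = _
    rw [Polynomial.map_prod]
    simp
  have hcoeff : ∀ {S : Polynomial (integers hν)}, (∀ i, ((S.coeff i : integers hν) : E) = P.coeff i) →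
      ∀ i, (S.map (Ideal.Quotient.mk (integersIdeal hν))).coeff i = 0 ↔ ν (P.coeff i) < 1 := by
    intro S hS i
    rw [coeff_map, Ideal.Quotient.eq_zero_iff_mem, mem_integersIdeal, hS]
  constructor
  · intro hW1 hlt
    obtain ⟨R, S, hS, hR⟩ := main hW1
    have hne : S.map (Ideal.Quotient.mk (integersIdeal hν)) ≠ 0 := fun h => by
      have := (hcoeff hS k).1 (by rw [h, coeff_zero])
      exact this.ne hk
    have hd : (S.map (Ideal.Quotient.mk (integersIdeal hν))).natDegree ≤ k := by
      rw [natDegree_le_iff_coeff_eq_zero]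
      exact fun i hi => (hcoeff hS i).2 (hlt i hi)
    have := natDegree_le_of_dvd (Dvd.intro _ hR.symm) hne
    rw [natDegree_prod_of_monic _ _ fun _ _ => monic_X_sub_C _] at this
    simp only [natDegree_X_sub_C, Finset.sum_const, Finset.card_attach, smul_eq_mul,
      mul_one] at this
    exact this.trans hd
  · intro hW1
    obtain ⟨R, S, hS, hR⟩ := main fun w hw => (hW1 w hw).le
    by_contra! hlt
    have h0 : ∀ w : W, Ideal.Quotient.mk (integersIdeal hν)
        (⟨w, (hW1 w w.2).le⟩ : integers hν) = 0 := fun w =>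
      Ideal.Quotient.eq_zero_iff_mem.2 (hW1 w w.2)
    simp only [h0, map_zero, sub_zero, Finset.prod_const, Finset.card_attach] at hR
    have := (hcoeff hS k).1 (by rw [hR, coeff_X_pow_mul', if_neg (by omega)])
    exact this.ne hk

end Nonarch

section Torsion

variable {Fq : Type} [Field Fq] {q r : ℕ}
  {φ : Polynomial Fq →+* AddMonoid.End (Kbar Fq)}

theorem phi_mul_apply (φ : Polynomial Fq →+* AddMonoid.End (Kbar Fq)) (a b : Polynomial Fq)
    (x : Kbar Fq) : φ (a * b) x = φ a (φ b x) := by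
  rw [map_mul]; rfl

theorem phi_comm (φ : Polynomial Fq →+* AddMonoid.End (Kbar Fq)) (a b : Polynomial Fq)
    (x : Kbar Fq) : φ a (φ b x) = φ b (φ a x) := by
  rw [← phi_mul_apply, mul_comm, phi_mul_apply]

theorem phi_add_apply (φ : Polynomial Fq →+* AddMonoid.End (Kbar Fq)) (a b : Polynomial Fq)
    (x : Kbar Fq) : φ (a + b) x = φ a x + φ b x := by
  rw [map_add]; rfl

theorem phi_one_apply (φ : Polynomial Fq →+* AddMonoid.End (Kbar Fq))
    (x : Kbar Fq) : φ 1 x = x := by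
  rw [map_one]; rfl

theorem phi_zero_apply (φ : Polynomial Fq →+* AddMonoid.End (Kbar Fq))
    (x : Kbar Fq) : φ 0 x = 0 := by
  rw [map_zero]; rfl

theorem phi_equiv (hφ : IsDrinfeldPhi Fq q r φ) (σ : Kbar Fq ≃ₐ[RatFunc Fq] Kbar Fq)
    (a : Polynomial Fq) (x : Kbar Fq) : φ a (σ x) = σ (φ a x) := by
  rw [← aeval_torsionPoly hφ, ← aeval_torsionPoly hφ]
  exact aeval_algHom_apply (σ.toAlgHom.restrictScalars (Polynomial Fq)) x _

/-- The polynomial `torsionPoly` with coefficients in `F̄`. -/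
abbrev torsionPolyBar (Fq : Type) [Field Fq] (q r : ℕ) (a : Polynomial Fq) : Polynomial (Kbar Fq) :=
  (torsionPoly q r a).map (algebraMap (Polynomial Fq) (Kbar Fq))

theorem algebraMap_Kbar_injective : Function.Injective (algebraMap (Polynomial Fq) (Kbar Fq)) := by
  rw [IsScalarTower.algebraMap_eq (Polynomial Fq) (RatFunc Fq) (Kbar Fq)]
  exact (algebraMap (RatFunc Fq) (Kbar Fq)).injective.comp (RatFunc.algebraMap_injective Fq)

theorem algebraMap_Kbar_ne_zero {a : Polynomial Fq} (ha : a ≠ 0) :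
    algebraMap (Polynomial Fq) (Kbar Fq) a ≠ 0 := by
  rwa [Ne, map_eq_zero_iff _ algebraMap_Kbar_injective]

theorem eval_torsionPolyBar (hφ : IsDrinfeldPhi Fq q r φ) (a : Polynomial Fq) (x : Kbar Fq) :
    (torsionPolyBar Fq q r a).eval x = φ a x := by
  rw [← aeval_torsionPoly hφ, eval_map, aeval_def]

theorem separable_torsionPoly [Fintype Fq] (hq : Fintype.card Fq = q) (hr : 1 < r)
    {a : Polynomial Fq} (ha : a ≠ 0) :
    ((torsionPoly q r a).map (algebraMap (Polynomial Fq) (RatFunc Fq))).Separable := by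
  rw [separable_def, derivative_map, derivative_torsionPoly hq hr, map_C]
  have h : algebraMap (Polynomial Fq) (RatFunc Fq) a ≠ 0 := by simpa using ha
  exact ⟨0, C (algebraMap (Polynomial Fq) (RatFunc Fq) a)⁻¹, by
    rw [zero_mul, zero_add, ← C_mul, inv_mul_cancel₀ h, C_1]⟩

theorem mem_rootSet_torsionPoly [Fintype Fq] (hq : Fintype.card Fq = q) (hr : 1 < r)
    (hφ : IsDrinfeldPhi Fq q r φ) {a : Polynomial Fq} (ha : a ≠ 0) {x : Kbar Fq} :
    x ∈ ((torsionPoly q r a).map (algebraMap (Polynomial Fq) (RatFunc Fq))).rootSet (Kbar Fq) ↔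
      φ a x = 0 := by
  rw [mem_rootSet_of_ne, aeval_map_algebraMap, aeval_torsionPoly hφ]
  exact (separable_torsionPoly hq hr ha).ne_zero

theorem finite_torsion [Fintype Fq] (hq : Fintype.card Fq = q) (hr : 1 < r)
    (hφ : IsDrinfeldPhi Fq q r φ) {a : Polynomial Fq} (ha : a ≠ 0) : {x | φ a x = 0}.Finite := by
  convert rootSet_finite ((torsionPoly q r a).map (algebraMap (Polynomial Fq) (RatFunc Fq)))
    (Kbar Fq)
  ext x
  exact (mem_rootSet_torsionPoly hq hr hφ ha).symm

theorem ncard_torsion [Fintype Fq] (hq : Fintype.card Fq = q) (hr : 1 < r)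
    (hφ : IsDrinfeldPhi Fq q r φ) {a : Polynomial Fq} (ha : a ≠ 0) :
    {x | φ a x = 0}.ncard = q ^ (r * a.natDegree) := by
  have hq1 : 1 < q := hq ▸ Fintype.one_lt_card
  have h : {x | φ a x = 0} =
      ((torsionPoly q r a).map (algebraMap (Polynomial Fq) (RatFunc Fq))).rootSet (Kbar Fq) := by
    ext x
    exact (mem_rootSet_torsionPoly hq hr hφ ha).symm
  rw [h, ← Nat.card_coe_set_eq, Nat.card_eq_fintype_card,
    card_rootSet_eq_natDegree (separable_torsionPoly hq hr ha) (IsAlgClosed.splits _),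
    natDegree_map_eq_of_injective (RatFunc.algebraMap_injective Fq),
    (natDegree_torsionPoly hq1 (by omega) ha).1]

theorem separable_minpoly_torsion [Fintype Fq] (hq : Fintype.card Fq = q) (hr : 1 < r)
    (hφ : IsDrinfeldPhi Fq q r φ) {a : Polynomial Fq} (ha : a ≠ 0) {x : Kbar Fq}
    (hx : φ a x = 0) : (minpoly (RatFunc Fq) x).Separable := by
  refine (separable_torsionPoly hq hr ha).of_dvd (minpoly.dvd _ _ ?_)
  rw [aeval_map_algebraMap, aeval_torsionPoly hφ, hx]

theorem coeff_torsionPolyBar_zero (hq : 1 < q) (a : Polynomial Fq) :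
    (torsionPolyBar Fq q r a).coeff 0 = 0 := by
  rw [coeff_map, coeff_zero_torsionPoly hq, map_zero]

theorem coeff_torsionPolyBar_one [Fintype Fq] (hq : Fintype.card Fq = q) (hr : 1 < r)
    (a : Polynomial Fq) :
    (torsionPolyBar Fq q r a).coeff 1 = algebraMap (Polynomial Fq) (Kbar Fq) a := by
  rw [coeff_map, coeff_one_torsionPoly hq hr]

/-- The `q`-power map is additive on `F̄`. -/
theorem sub_pow_card_Kbar [Fintype Fq] (hq : Fintype.card Fq = q) (k : ℕ) (x y : Kbar Fq) :
    (x - y) ^ q ^ k = x ^ q ^ k - y ^ q ^ k := by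
  induction k generalizing x y with
  | zero => simp
  | succ k ih =>
    have h (x : Kbar Fq) : FiniteField.frobeniusAlgHom Fq (Kbar Fq) x = x ^ q := by
      rw [FiniteField.coe_frobeniusAlgHom, hq]
    rw [pow_succ, pow_mul, ih, ← h, map_sub, h, h, ← pow_mul, ← pow_mul]

variable {ν : AbsoluteValue (Kbar Fq) ℝ}

theorem abs_phi_le_one (hφ : IsDrinfeldPhi Fq q r φ) (hν : IsNonarchimedean ν)
    (hA : ∀ b : Polynomial Fq, ν (algebraMap _ _ b) ≤ 1) (a : Polynomial Fq) {x : Kbar Fq}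
    (hx : ν x ≤ 1) : ν (φ a x) ≤ 1 := by
  rw [← eval_torsionPolyBar hφ]
  exact nonarch_eval_le_one hν (fun i => by rw [coeff_map]; exact hA _) hx

/-- Torsion points are integral at the places where `T` is a unit. -/
theorem abs_torsion_le_one (hq : 1 < q) (hr : 1 < r) (hφ : IsDrinfeldPhi Fq q r φ)
    (hν : IsNonarchimedean ν) (hA : ∀ b : Polynomial Fq, ν (algebraMap _ _ b) ≤ 1)
    (hX : ν (algebraMap (Polynomial Fq) _ X) = 1)
    (hC : ∀ c : Fq, c ≠ 0 → ν (algebraMap (Polynomial Fq) _ (C c)) = 1)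
    {a : Polynomial Fq} (ha : a ≠ 0) {x : Kbar Fq} (hx : φ a x = 0) : ν x ≤ 1 := by
  refine nonarch_root_le_one hν (P := torsionPolyBar Fq q r a)
    (fun i => by rw [coeff_map]; exact hA _) ?_ (by rw [eval_torsionPolyBar hφ, hx])
  obtain ⟨m, hm⟩ := (natDegree_torsionPoly (r := r) hq (by omega) ha).2
  rw [leadingCoeff_map_of_injective algebraMap_Kbar_injective, hm, map_mul, map_mul, map_pow,
    map_pow, hX, one_pow, mul_one, hC _ (leadingCoeff_ne_zero.2 ha)]

/-- Reduction is injective on torsion of order prime to the residue characteristic. -/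
theorem torsion_eq_zero_of_abs_lt_one [Fintype Fq] (hq : Fintype.card Fq = q) (hr : 1 < r)
    (hφ : IsDrinfeldPhi Fq q r φ) (hν : IsNonarchimedean ν)
    (hA : ∀ b : Polynomial Fq, ν (algebraMap _ _ b) ≤ 1)
    {a : Polynomial Fq} (ha : ν (algebraMap _ _ a) = 1) {x : Kbar Fq} (hx : φ a x = 0)
    (hx1 : ν x < 1) : x = 0 :=
  nonarch_small_root hν (P := torsionPolyBar Fq q r a)
    (fun i => by rw [coeff_map]; exact hA _)
    (coeff_torsionPolyBar_zero (hq ▸ Fintype.one_lt_card) a)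
    (by rw [coeff_torsionPolyBar_one hq hr, ha])
    (by rw [eval_torsionPolyBar hφ, hx]) hx1

/-- Inertia acts trivially on integral torsion of order prime to the residue characteristic. -/
theorem inertia_fixes_torsion [Fintype Fq] (hq : Fintype.card Fq = q) (hr : 1 < r)
    (hφ : IsDrinfeldPhi Fq q r φ) (P : InertiaPlace (RatFunc Fq))
    (hA : ∀ b : Polynomial Fq, P.ν (algebraMap _ _ b) ≤ 1)
    {a : Polynomial Fq} (ha : P.ν (algebraMap _ _ a) = 1) {x : Kbar Fq} (hx : φ a x = 0)
    (hx1 : P.ν x ≤ 1) {σ : Kbar Fq ≃ₐ[RatFunc Fq] Kbar Fq} (hσ : σ ∈ P.H) : σ x = x := by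
  rw [← sub_eq_zero]
  refine torsion_eq_zero_of_abs_lt_one hq hr hφ P.nonarch hA ha ?_ (P.inert σ hσ x hx1)
  rw [map_sub, phi_equiv hφ, hx, map_zero, sub_zero]

/-- At a place above `T`, at most `q^{(r-1) deg a}` of the `a`-torsion points are integral. -/
theorem ncard_integral_torsion_le [Fintype Fq] (hq : Fintype.card Fq = q) (hr : 1 < r)
    (hφ : IsDrinfeldPhi Fq q r φ) (hν : IsNonarchimedean ν)
    (hA : ∀ b : Polynomial Fq, ν (algebraMap _ _ b) ≤ 1)
    (hX : ν (algebraMap (Polynomial Fq) _ X) < 1)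
    (hunit : ∀ b : Polynomial Fq, ¬ X ∣ b → ν (algebraMap _ _ b) = 1)
    {a : Polynomial Fq} (ha : a ≠ 0) :
    {x | φ a x = 0 ∧ ν x ≤ 1}.ncard ≤ q ^ ((r - 1) * a.natDegree) := by
  have hq1 : 1 < q := hq ▸ Fintype.one_lt_card
  have hfin : {x | φ a x = 0 ∧ ν x ≤ 1}.Finite :=
    (finite_torsion hq hr hφ ha).subset fun x hx => hx.1
  have hdeg := map_torsionPoly (q := q) (r := r) hq1 hr ha
  have hcoeff : ∀ i, ((torsionPoly q r a).map (evalRingHom 0)).coeff i = 0 ↔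
      X ∣ (torsionPoly q r a).coeff i := fun i => by
    rw [coeff_map, coe_evalRingHom, X_dvd_iff, coeff_zero_eq_eval_zero]
  rw [Set.ncard_eq_toFinset_card _ hfin]
  refine (nonarch_card_roots_le hν (P := torsionPolyBar Fq q r a)
    (fun i => by rw [coeff_map]; exact hA _) (k := q ^ ((r - 1) * a.natDegree)) ?_
    (W := hfin.toFinset) ?_).1 ?_ ?_
  · rw [coeff_map]
    refine hunit _ ?_
    rw [← hcoeff, ← hdeg]
    change leadingCoeff _ ≠ 0
    rw [leadingCoeff_ne_zero]
    intro h
    rw [h, natDegree_zero] at hdeg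
    have : 0 < q ^ ((r - 1) * a.natDegree) := by positivity
    omega
  · intro w hw
    rw [eval_torsionPolyBar hφ]
    exact (hfin.mem_toFinset.1 hw).1
  · exact fun w hw => (hfin.mem_toFinset.1 hw).2
  · intro i hi
    rw [← hdeg] at hi
    obtain ⟨b, hb⟩ := (hcoeff i).1 (coeff_eq_zero_of_natDegree_lt hi)
    rw [coeff_map, hb, map_mul, map_mul]
    exact mul_lt_one_of_nonneg_of_lt_one_left (by positivity) hX (hA b)

end Torsion

section PlaceT

variable {Fq : Type} [Field Fq] {q r : ℕ}
  {φ : Polynomial Fq →+* AddMonoid.End (Kbar Fq)} {ν : AbsoluteValue (Kbar Fq) ℝ}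

/-- If the absolute values of the `φ_{T^i}(x)` increase strictly up to `i = deg a`, then the last
one is the absolute value of `φ_a(x)`. -/
theorem abs_phi_of_strictly_increasing (hφ : IsDrinfeldPhi Fq q r φ) (hν : IsNonarchimedean ν)
    (hC : ∀ c : Fq, c ≠ 0 → ν (algebraMap (Polynomial Fq) _ (C c)) = 1)
    {a : Polynomial Fq} (ha : a ≠ 0) {x : Kbar Fq} (hx : x ≠ 0)
    (h : ∀ i < a.natDegree, ν (φ (X ^ i) x) < ν (φ (X ^ (i + 1)) x)) :
    ν (φ a x) = ν (φ (X ^ a.natDegree) x) ∧ φ a x ≠ 0 := by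
  have hmono : ∀ i j, i < j → j ≤ a.natDegree → ν (φ (X ^ i) x) < ν (φ (X ^ j) x) := by
    intro i j hij hj
    induction j, hij using Nat.le_induction with
    | base => exact h i (by omega)
    | succ j _ ih => exact (ih (by omega)).trans (h j (by omega))
  have hsum : φ a x = ∑ i ∈ Finset.range (a.natDegree + 1), φ (C (a.coeff i) * X ^ i) x := by
    conv_lhs => rw [a.as_sum_range_C_mul_X_pow, map_sum]
    exact AddMonoidHom.finsetSum_apply _ _ x
  have hterm : ∀ i, ν (φ (C (a.coeff i) * X ^ i) x) ≤ ν (φ (X ^ i) x) := by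
    intro i
    rw [phi_mul_apply, phi_C hφ, map_mul]
    by_cases hc : a.coeff i = 0
    · rw [hc]; simp
    · rw [hC _ hc, one_mul]
  have htop : ν (φ (C (a.coeff a.natDegree) * X ^ a.natDegree) x) = ν (φ (X ^ a.natDegree) x) := by
    rw [phi_mul_apply, phi_C hφ, map_mul, hC (a.coeff a.natDegree) (leadingCoeff_ne_zero.2 ha), one_mul]
  have h1 : ν (φ a x) = ν (φ (X ^ a.natDegree) x) := by
    rw [hsum, hν.apply_sum_eq_of_lt (fun a => (ν.map_neg a).symm)
      (k := a.natDegree) (by simp), htop]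
    intro j hj hjn
    have : j < a.natDegree := by
      have := Finset.mem_range.1 hj
      omega
    exact (hterm j).trans_lt (htop ▸ hmono j _ this le_rfl)
  refine ⟨h1, fun h0 => ?_⟩
  rw [h0, map_zero] at h1
  rcases Nat.eq_zero_or_pos a.natDegree with hn | hn
  · rw [hn, pow_zero, phi_one_apply] at h1
    exact (ν.pos hx).ne h1
  · have := hmono 0 _ hn le_rfl
    rw [← h1] at this
    exact this.not_ge (by positivity)

variable (hq : 1 < q) (hr : 1 < r) (hφ : IsDrinfeldPhi Fq q r φ) (hν : IsNonarchimedean ν)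
  (hX : ν (algebraMap (Polynomial Fq) _ X) < 1)

include hr in
theorem pow_card_pow_eq {M : Type*} [Monoid M] (x : M) : x ^ q ^ r = (x ^ q ^ (r - 1)) ^ q := by
  rw [← pow_mul, ← pow_succ, Nat.sub_add_cancel hr.le]

include hq hr in
theorem lt_pow_of_one_lt {x : ℝ} (hx : 1 < x) : x < x ^ q ^ (r - 1) := by
  have : 1 < q ^ (r - 1) := Nat.one_lt_pow (by omega) hq
  simpa using pow_lt_pow_right₀ hx this

theorem abs_T_pos (ν : AbsoluteValue (Kbar Fq) ℝ) : 0 < ν (algebraMap (Polynomial Fq) _ X) :=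
  ν.pos (algebraMap_Kbar_ne_zero X_ne_zero)

include hq hr hφ hν hX

theorem abs_phi_T_of_lt {x : Kbar Fq} (hx : 1 < ν x)
    (h : ν (algebraMap (Polynomial Fq) _ X) * ν x ^ q ^ (r - 1) < 1) :
    ν (φ X x) = ν x ^ q ^ (r - 1) := by
  have hT := abs_T_pos ν
  have h1 := lt_pow_of_one_lt hq hr hx
  rw [phi_X hφ, pow_card_pow_eq hr, hν.add_eq_left_of_lt, hν.add_eq_right_of_lt, map_pow]
  · rw [map_mul, map_pow]
    exact (mul_lt_of_lt_one_left (by positivity) hX).trans h1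
  · rw [hν.add_eq_right_of_lt]
    · rw [map_mul, map_pow, map_pow, map_pow]
      set y := ν x ^ q ^ (r - 1)
      have hy : 0 < y := by positivity
      calc ν (algebraMap _ _ X) ^ (q - 1) * y ^ q
          = (ν (algebraMap _ _ X) * y) ^ (q - 1) * y := by
            rw [mul_pow, mul_assoc, ← pow_succ, Nat.sub_add_cancel hq.le]
        _ < 1 * y := by
            gcongr
            exact pow_lt_one₀ (by positivity) h (by omega)
        _ = y := one_mul y
    · rw [map_mul, map_pow]
      exact (mul_lt_of_lt_one_left (by positivity) hX).trans h1

theorem lt_abs_phi_T_of_gt {x : Kbar Fq} (hx : 1 < ν x)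
    (h : 1 < ν (algebraMap (Polynomial Fq) _ X) * ν x ^ q ^ (r - 1)) :
    ν x < ν (φ X x) := by
  have hT := abs_T_pos ν
  have h1 := lt_pow_of_one_lt hq hr hx
  set y := ν x ^ q ^ (r - 1) with hy
  have hy0 : 0 < y := by positivity
  have h3 : y < ν (algebraMap (Polynomial Fq) _ X) ^ (q - 1) * y ^ q := by
    calc y = 1 * y := (one_mul y).symm
      _ < (ν (algebraMap _ _ X) * y) ^ (q - 1) * y := by
            gcongr
            exact one_lt_pow₀ h (by omega)
      _ = ν (algebraMap _ _ X) ^ (q - 1) * y ^ q := by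
            rw [mul_pow, mul_assoc, ← pow_succ, Nat.sub_add_cancel hq.le]
  have h2 : ν (algebraMap (Polynomial Fq) _ X * x + x ^ q ^ (r - 1)) = y := by
    rw [hν.add_eq_right_of_lt, map_pow]
    rw [map_mul, map_pow]
    exact (mul_lt_of_lt_one_left (by positivity) hX).trans h1
  rw [phi_X hφ, pow_card_pow_eq hr, hν.add_eq_right_of_lt]
  · rw [map_mul, map_pow, map_pow, map_pow, ← hy]
    exact h1.trans h3
  · rwa [h2, map_mul, map_pow, map_pow, map_pow, ← hy]

variable (hC : ∀ c : Fq, c ≠ 0 → ν (algebraMap (Polynomial Fq) _ (C c)) = 1)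
include hC

/-- Torsion points satisfy `|x|^{q^{r-1}} ≤ |T|⁻¹`. -/
theorem abs_torsion_le {a : Polynomial Fq} (ha : a ≠ 0) {x : Kbar Fq} (hx : φ a x = 0) :
    ν (algebraMap (Polynomial Fq) _ X) * ν x ^ q ^ (r - 1) ≤ 1 := by
  have hT := abs_T_pos ν
  rcases le_or_gt (ν x) 1 with h1 | h1
  · exact mul_le_one₀ hX.le (by positivity) (pow_le_one₀ (by positivity) h1)
  by_contra! h
  have key : ∀ i, 1 < ν (φ (X ^ i) x) ∧
      1 < ν (algebraMap (Polynomial Fq) _ X) * ν (φ (X ^ i) x) ^ q ^ (r - 1) := by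
    intro i
    induction i with
    | zero => rw [pow_zero, phi_one_apply]; exact ⟨h1, h⟩
    | succ i ih =>
      have := lt_abs_phi_T_of_gt hq hr hφ hν hX ih.1 ih.2
      rw [pow_succ', phi_mul_apply]
      refine ⟨ih.1.trans this, ih.2.trans_le ?_⟩
      gcongr
  refine (abs_phi_of_strictly_increasing hφ hν hC ha (x := x) ?_ fun i _ => ?_).2 hx
  · rintro rfl
    rw [map_zero] at h1
    exact absurd h1 (by norm_num)
  · rw [pow_succ', phi_mul_apply]
    exact lt_abs_phi_T_of_gt hq hr hφ hν hX (key i).1 (key i).2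

/-- Non-integral torsion points have a level `L ≥ 1`, with `|x|^{q^{(r-1)L}} = |T|⁻¹`. -/
theorem exists_torsion_level {a : Polynomial Fq} (ha : a ≠ 0) {x : Kbar Fq} (hx : φ a x = 0)
    (h1 : 1 < ν x) : ∃ L, 0 < L ∧ L ≤ a.natDegree ∧
      ν (algebraMap (Polynomial Fq) _ X) * ν x ^ (q ^ (r - 1)) ^ L = 1 ∧
      ∀ i < L, ν (φ (X ^ i) x) = ν x ^ (q ^ (r - 1)) ^ i := by
  have hT := abs_T_pos ν
  have hQ : 1 < q ^ (r - 1) := Nat.one_lt_pow (by omega) hq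
  have hex : ∃ L, 1 ≤ ν (algebraMap (Polynomial Fq) _ X) * ν x ^ (q ^ (r - 1)) ^ L := by
    obtain ⟨m, hm⟩ := pow_unbounded_of_one_lt (ν (algebraMap (Polynomial Fq) _ X))⁻¹ h1
    refine ⟨m, ?_⟩
    rw [← mul_inv_cancel₀ hT.ne']
    gcongr
    refine hm.le.trans (pow_le_pow_right₀ h1.le (Nat.lt_pow_self hQ).le)
  have htor : ∀ b, φ a (φ b x) = 0 := fun b => by rw [phi_comm, hx, map_zero]
  classical
  obtain ⟨hL1, hmin⟩ : (1 ≤ ν (algebraMap (Polynomial Fq) _ X) *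
      ν x ^ (q ^ (r - 1)) ^ Nat.find hex) ∧ ∀ i < Nat.find hex,
      ν (algebraMap (Polynomial Fq) _ X) * ν x ^ (q ^ (r - 1)) ^ i < 1 :=
    ⟨Nat.find_spec hex, fun i hi => not_le.1 (Nat.find_min hex hi)⟩
  set L := Nat.find hex
  have hL0 : 0 < L := by
    rw [Nat.pos_iff_ne_zero]
    intro h0
    rw [h0, pow_zero, pow_one] at hL1
    have h2 := abs_torsion_le hq hr hφ hν hX hC ha hx
    have h3 := lt_pow_of_one_lt hq hr h1
    have h4 : ν (algebraMap (Polynomial Fq) _ X) * ν x <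
      ν (algebraMap (Polynomial Fq) _ X) * ν x ^ q ^ (r - 1) := by gcongr
    linarith
  have hnorm : ∀ i < L, ν (φ (X ^ i) x) = ν x ^ (q ^ (r - 1)) ^ i := by
    intro i hi
    induction i with
    | zero => rw [pow_zero, phi_one_apply, pow_zero, pow_one]
    | succ i ih =>
      have h2 := ih (by omega)
      have hQi : (q ^ (r - 1)) ^ i ≠ 0 := by positivity
      rw [pow_succ', phi_mul_apply, abs_phi_T_of_lt hq hr hφ hν hX, h2, ← pow_mul, ← pow_succ]
      · rw [h2]; exact one_lt_pow₀ h1 hQi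
      · rw [h2, ← pow_mul, ← pow_succ]; exact hmin _ hi
  refine ⟨L, hL0, ?_, le_antisymm ?_ hL1, hnorm⟩
  · by_contra! hlt
    refine (abs_phi_of_strictly_increasing hφ hν hC ha (x := x) ?_ fun i hi => ?_).2 hx
    · rintro rfl
      rw [map_zero] at h1
      exact absurd h1 (by norm_num)
    · rw [hnorm i (by omega), hnorm (i + 1) (by omega)]
      exact pow_lt_pow_right₀ h1 (Nat.pow_lt_pow_right hQ (by omega))
  · have := abs_torsion_le hq hr hφ hν hX hC ha (htor (X ^ (L - 1)))
    rwa [hnorm _ (by omega), ← pow_mul, ← pow_succ, Nat.sub_add_cancel hL0] at this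

end PlaceT

section PlaceT

variable {Fq : Type} [Field Fq] {q r : ℕ}
  {φ : Polynomial Fq →+* AddMonoid.End (Kbar Fq)} {ν : AbsoluteValue (Kbar Fq) ℝ}

theorem pow_card_sub_self_eq_prod [Fintype Fq] (hq : Fintype.card Fq = q) (x : Kbar Fq) :
    x ^ q - x = ∏ c : Fq, (x - algebraMap (Polynomial Fq) (Kbar Fq) (C c)) := by
  have hq1 : 1 < q := hq ▸ Fintype.one_lt_card
  have hdeg := FiniteField.X_pow_card_sub_X_natDegree_eq Fq hq1
  have h : (∏ c : Fq, (X - C c)) = (X ^ q - X : Polynomial Fq) := by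
    have hroots := FiniteField.roots_X_pow_card_sub_X Fq
    rw [hq] at hroots
    have := prod_multiset_X_sub_C_of_monic_of_roots_card_eq (p := (X ^ q - X : Polynomial Fq))
      (monic_X_pow_sub (n := q) (by rw [degree_X]; exact_mod_cast hq1)) (by
        rw [hroots, hdeg, ← hq]; rfl)
    rw [hroots] at this
    exact this
  have h2 := congrArg (eval₂ ((algebraMap (Polynomial Fq) (Kbar Fq)).comp C) x) h
  rw [eval₂_finsetProd] at h2
  simpa using h2.symm

variable [Fintype Fq] (hq : Fintype.card Fq = q) (hr : 1 < r) (hφ : IsDrinfeldPhi Fq q r φ)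
  (hν : IsNonarchimedean ν)
  (hX : ν (algebraMap (Polynomial Fq) _ X) < 1)
  (hC : ∀ c : Fq, c ≠ 0 → ν (algebraMap (Polynomial Fq) _ (C c)) = 1)
include hq hr hφ hν hX hC

theorem exists_const_abs_sub_lt_of_level_one {a : Polynomial Fq} (ha : a ≠ 0) {x y : Kbar Fq}
    (hx : φ a x = 0) (hy : φ a y = 0) (hxy : ν x = ν y) (h1 : 1 < ν x)
    (hL : ν (algebraMap (Polynomial Fq) _ X) * ν x ^ q ^ (r - 1) = 1) :
    ∃ c : Fq, ν (y - algebraMap (Polynomial Fq) _ (C c) * x) < ν x := by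
  have hq1 : 1 < q := hq ▸ Fintype.one_lt_card
  have hT := abs_T_pos ν
  have hQ : q ^ (r - 1) ≠ 0 := by positivity
  have hx0 : x ≠ 0 := by rintro rfl; rw [map_zero] at h1; exact absurd h1 (by norm_num)
  have small : ∀ t, φ a t = 0 → ν t = ν x →
      ν (t ^ q ^ (r - 1) + algebraMap (Polynomial Fq) _ X ^ (q - 1) * (t ^ q ^ (r - 1)) ^ q)
        < ν x ^ q ^ (r - 1) := by
    intro t ht htx
    have e : t ^ q ^ (r - 1) + algebraMap (Polynomial Fq) _ X ^ (q - 1) * (t ^ q ^ (r - 1)) ^ q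
        = φ X t - algebraMap (Polynomial Fq) _ X * t := by
      rw [phi_X hφ, pow_card_pow_eq hr]; ring
    rw [e]
    refine (nonarch_sub_le hν _ _).trans_lt (max_lt ?_ ?_)
    · by_contra! hge
      have h2 := abs_torsion_le hq1 hr hφ hν hX hC ha (x := φ X t) (by rw [phi_comm, ht, map_zero])
      have h3 : 1 < ν (φ X t) := (one_lt_pow₀ h1 hQ).trans_le hge
      have h4 := hge.trans_lt (lt_pow_of_one_lt hq1 hr h3)
      have h5 : ν (algebraMap (Polynomial Fq) _ X) * ν x ^ q ^ (r - 1) <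
        ν (algebraMap (Polynomial Fq) _ X) * ν (φ X t) ^ q ^ (r - 1) := by gcongr
      linarith
    · rw [map_mul, htx]
      exact (mul_lt_of_lt_one_left (by positivity) hX).trans (lt_pow_of_one_lt hq1 hr h1)
  set w := y / x with hw
  have hyw : y = w * x := by rw [hw, div_mul_cancel₀ _ hx0]
  have hw1 : ν w = 1 := by rw [hw, map_div₀, ← hxy, div_self (by positivity)]
  have e : x ^ q ^ (r - 1) * (w - w ^ q) ^ q ^ (r - 1) =
      (y ^ q ^ (r - 1) + algebraMap (Polynomial Fq) _ X ^ (q - 1) * (y ^ q ^ (r - 1)) ^ q) -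
      (w ^ q ^ (r - 1)) ^ q *
      (x ^ q ^ (r - 1) + algebraMap (Polynomial Fq) _ X ^ (q - 1) * (x ^ q ^ (r - 1)) ^ q) := by
    rw [sub_pow_card_Kbar hq, hyw, mul_pow w x, ← pow_mul w q, mul_comm q, pow_mul w _ q]
    ring
  have h2 : ν (x ^ q ^ (r - 1) * (w - w ^ q) ^ q ^ (r - 1)) < ν x ^ q ^ (r - 1) := by
    rw [e]
    refine (nonarch_sub_le hν _ _).trans_lt (max_lt (small y hy hxy.symm) ?_)
    rw [map_mul, map_pow, map_pow, hw1, one_pow, one_pow, one_mul]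
    exact small x hx rfl
  rw [map_mul, map_pow, map_pow] at h2
  have h3 : ν (w - w ^ q) < 1 := by
    have h4 : ν (w - w ^ q) ^ q ^ (r - 1) < 1 :=
      lt_of_mul_lt_mul_left (a := ν x ^ q ^ (r - 1)) (by simpa using h2) (by positivity)
    by_contra! h5
    exact absurd h4 (one_le_pow₀ h5).not_gt
  rw [ν.map_sub, pow_card_sub_self_eq_prod hq, map_prod] at h3
  obtain ⟨c, -, hc⟩ : ∃ c ∈ (Finset.univ : Finset Fq),
      ν (w - algebraMap (Polynomial Fq) (Kbar Fq) (C c)) < 1 := by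
    by_contra! hcon
    exact absurd h3 (Finset.one_le_prod hcon).not_gt
  refine ⟨c, ?_⟩
  rw [hyw, ← sub_mul, map_mul]
  exact mul_lt_of_lt_one_left (by positivity) hc

/-- Two non-integral torsion points of the same absolute value are, up to a constant,
congruent modulo smaller ones. -/
theorem exists_const_abs_sub_lt {a : Polynomial Fq} (ha : a ≠ 0) {x y : Kbar Fq}
    (hx : φ a x = 0) (hy : φ a y = 0) (hxy : ν x = ν y) (h1 : 1 < ν x) :
    ∃ c : Fq, ν (y - algebraMap (Polynomial Fq) _ (C c) * x) < ν x := by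
  have hq1 : 1 < q := hq ▸ Fintype.one_lt_card
  have hQ : 1 < q ^ (r - 1) := Nat.one_lt_pow (by omega) hq1
  have hT := abs_T_pos ν
  have hlevel : ∀ L L', ν (algebraMap (Polynomial Fq) _ X) * ν x ^ (q ^ (r - 1)) ^ L = 1 →
      ν (algebraMap (Polynomial Fq) _ X) * ν x ^ (q ^ (r - 1)) ^ L' = 1 → L = L' := by
    intro L L' h h'
    have h2 : ν x ^ (q ^ (r - 1)) ^ L = ν x ^ (q ^ (r - 1)) ^ L' :=
      mul_left_cancel₀ hT.ne' (h.trans h'.symm)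
    exact Nat.pow_right_injective hQ (pow_right_injective₀ (by positivity) h1.ne' h2)
  obtain ⟨L, hL0, -, hL, hnx⟩ := exists_torsion_level hq1 hr hφ hν hX hC ha hx h1
  have hsame : ∀ d, φ a d = 0 → ν d = ν x →
      ν (φ (X ^ (L - 1)) d) = ν x ^ (q ^ (r - 1)) ^ (L - 1) := by
    intro d hd hdx
    obtain ⟨L', hL'0, -, hL', hnd⟩ := exists_torsion_level hq1 hr hφ hν hX hC ha hd (hdx ▸ h1)
    rw [hdx] at hL' hnd
    obtain rfl := hlevel _ _ hL hL'
    exact hnd _ (by omega)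
  have htor : ∀ b {t}, φ a t = 0 → φ a (φ b t) = 0 := fun b t ht => by
    rw [phi_comm, ht, map_zero]
  have hzx := hsame x hx rfl
  obtain ⟨c, hc⟩ := exists_const_abs_sub_lt_of_level_one hq hr hφ hν hX hC ha
    (htor (X ^ (L - 1)) hx) (htor (X ^ (L - 1)) hy) (by rw [hzx, hsame y hy hxy.symm])
    (by rw [hzx]; exact one_lt_pow₀ h1 (by positivity))
    (by rw [hzx, ← pow_mul, ← pow_succ, Nat.sub_add_cancel hL0, hL])
  refine ⟨c, lt_of_le_of_ne ?_ fun h => ?_⟩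
  · refine (nonarch_sub_le hν _ _).trans (max_le hxy.ge ?_)
    rw [map_mul]
    by_cases hc0 : c = 0
    · subst hc0; simp
    · rw [hC c hc0, one_mul]
  · have hd := hsame _ (by
      rw [map_sub, hy, ← phi_C hφ, phi_comm, hx, map_zero, sub_zero]) h
    rw [map_sub, ← phi_C hφ, phi_comm, phi_C hφ, ← hzx] at hd
    exact hc.ne hd

variable (hA : ∀ b : Polynomial Fq, ν (algebraMap _ _ b) ≤ 1)
  (hunit : ∀ b : Polynomial Fq, ¬ X ∣ b → ν (algebraMap _ _ b) = 1)
include hA hunit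

/-- The structure of the `a`-torsion at a place above `T`: the integral torsion points form a
submodule of order `q^{(r-1) deg a}` with cyclic quotient. -/
theorem exists_torsion_generator {a : Polynomial Fq} (ha : 0 < a.natDegree) :
    ∃ z, φ a z = 0 ∧ 1 < ν z ∧
      ν (algebraMap (Polynomial Fq) _ X) * ν z ^ q ^ ((r - 1) * a.natDegree) = 1 ∧
      {x | φ a x = 0 ∧ ν x ≤ 1}.ncard = q ^ ((r - 1) * a.natDegree) ∧
      (∀ x, φ a x = 0 → ν x < ν z → ν x ≤ 1) ∧
      ∀ x, φ a x = 0 → ∃ b : Polynomial Fq, ν (x - φ b z) ≤ 1 := by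
  have hq1 : 1 < q := hq ▸ Fintype.one_lt_card
  have hQ : 1 < q ^ (r - 1) := Nat.one_lt_pow (by omega) hq1
  have hT := abs_T_pos ν
  have ha0 : a ≠ 0 := fun h => by rw [h, natDegree_zero] at ha; exact ha.false
  set n := a.natDegree with hn
  have hfin := finite_torsion hq hr hφ ha0
  have hcard := ncard_torsion hq hr hφ ha0
  have hWle := ncard_integral_torsion_le hq hr hφ hν hA hX hunit ha0
  have htor : ∀ b {t}, φ a t = 0 → φ a (φ b t) = 0 := fun b t ht => by
    rw [phi_comm, ht, map_zero]
  have hex : {x | φ a x = 0 ∧ 1 < ν x}.Nonempty := by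
    by_contra hne
    rw [Set.not_nonempty_iff_eq_empty] at hne
    have : {x | φ a x = 0 ∧ ν x ≤ 1} = {x | φ a x = 0} := by
      ext x
      refine ⟨fun h => h.1, fun h => ⟨h, ?_⟩⟩
      by_contra! h1
      have : x ∈ {x | φ a x = 0 ∧ 1 < ν x} := ⟨h, h1⟩
      rw [hne] at this
      exact this
    rw [this, hcard] at hWle
    have h2 : (r - 1) * n < r * n := Nat.mul_lt_mul_of_pos_right (by omega) ha
    exact absurd hWle (Nat.pow_lt_pow_right hq1 h2).not_ge
  obtain ⟨z, ⟨hz, hz1⟩, hmin⟩ := Set.exists_min_image _ ν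
    (hfin.subset fun x (hx : φ a x = 0 ∧ 1 < ν x) => hx.1) hex
  have hmin' : ∀ x, φ a x = 0 → ν x < ν z → ν x ≤ 1 := fun x hx hlt => by
    by_contra! h1
    exact absurd hlt (hmin x ⟨hx, h1⟩).not_gt
  obtain ⟨j, hj0, hjn, hj, hnz⟩ := exists_torsion_level hq1 hr hφ hν hX hC ha0 hz hz1
  have hspan : ∀ x, φ a x = 0 → ∃ b ∈ degreeLT Fq j, ν (x - φ b z) ≤ 1 := by
    intro x hx
    by_contra! hcon
    obtain ⟨x, ⟨hx, hxb⟩, hxmin⟩ := Set.exists_min_image _ ν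
      (hfin.subset fun x (hx : φ a x = 0 ∧ ∀ b ∈ degreeLT Fq j, 1 < ν (x - φ b z)) => hx.1)
      ⟨x, hx, hcon⟩
    have hx1 : 1 < ν x := by
      have := hxb 0 (Submodule.zero_mem _)
      rwa [phi_zero_apply, sub_zero] at this
    obtain ⟨i, hi0, -, hi, -⟩ := exists_torsion_level hq1 hr hφ hν hX hC ha0 hx hx1
    have hij : i ≤ j := by
      by_contra! hlt
      have h2 : ν z ^ (q ^ (r - 1)) ^ j < ν x ^ (q ^ (r - 1)) ^ i :=
        (pow_lt_pow_right₀ hz1 (Nat.pow_lt_pow_right hQ hlt)).trans_le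
          (pow_le_pow_left₀ (by positivity) (hmin x ⟨hx, hx1⟩) _)
      have h3 : ν (algebraMap (Polynomial Fq) _ X) * ν z ^ (q ^ (r - 1)) ^ j <
        ν (algebraMap (Polynomial Fq) _ X) * ν x ^ (q ^ (r - 1)) ^ i := by gcongr
      rw [hi, hj] at h3
      exact h3.false
    have heq : ν (φ (X ^ (j - i)) z) = ν x := by
      rw [hnz _ (by omega)]
      have hQi : (q ^ (r - 1)) ^ i ≠ 0 := by positivity
      rw [← pow_left_inj₀ (by positivity) (by positivity) hQi, ← pow_mul, ← pow_add,
        Nat.sub_add_cancel hij]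
      exact mul_left_cancel₀ hT.ne' (hj.trans hi.symm)
    obtain ⟨c, hc⟩ := exists_const_abs_sub_lt hq hr hφ hν hX hC ha0
      (htor (X ^ (j - i)) hz) hx heq (heq ▸ hx1)
    rw [heq] at hc
    refine absurd hc (hxmin _ ⟨?_, fun b hb => ?_⟩).not_gt
    · rw [map_sub, hx, ← phi_C hφ, phi_comm, htor _ hz, map_zero, sub_zero]
    · have := hxb (C c * X ^ (j - i) + b) (Submodule.add_mem _ ?_ hb)
      · rwa [phi_add_apply, phi_mul_apply, phi_C hφ, ← sub_sub] at this
      · rw [mem_degreeLT]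
        refine (degree_C_mul_X_pow_le _ _).trans_lt ?_
        exact_mod_cast (by omega : j - i < j)
  have hWfin : {x | φ a x = 0 ∧ ν x ≤ 1}.Finite := hfin.subset fun x hx => hx.1
  have : Finite (degreeLT Fq j) := Finite.of_equiv _ (degreeLTEquiv Fq j).symm.toEquiv
  have hPcard : (degreeLT Fq j : Set (Polynomial Fq)).ncard = q ^ j := by
    rw [← Nat.card_coe_set_eq, SetLike.coe_sort_coe, Nat.card_congr (degreeLTEquiv Fq j).toEquiv]
    simp [hq]
  have hsub : {x | φ a x = 0} ⊆ (fun p : Kbar Fq × Polynomial Fq => p.1 + φ p.2 z) ''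
      ({x | φ a x = 0 ∧ ν x ≤ 1} ×ˢ (degreeLT Fq j : Set (Polynomial Fq))) := by
    intro x hx
    obtain ⟨b, hb, hxb⟩ := hspan x hx
    exact ⟨(x - φ b z, b), ⟨⟨by rw [map_sub, hx, htor b hz, sub_zero], hxb⟩, hb⟩,
      sub_add_cancel _ _⟩
  have hprod : ({x | φ a x = 0 ∧ ν x ≤ 1} ×ˢ (degreeLT Fq j : Set (Polynomial Fq))).Finite :=
    hWfin.prod (Set.toFinite _)
  have hle : q ^ (r * n) ≤ {x | φ a x = 0 ∧ ν x ≤ 1}.ncard * q ^ j := by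
    rw [← hcard, ← hPcard, ← Set.ncard_prod]
    exact (Set.ncard_le_ncard hsub (hprod.image _)).trans (Set.ncard_image_le hprod)
  have hrn : r * n = (r - 1) * n + n := by
    rw [← Nat.succ_mul, Nat.succ_eq_add_one, Nat.sub_add_cancel hr.le]
  have hjn' : j = n := by
    refine le_antisymm hjn ?_
    have h2 : q ^ (r * n) ≤ q ^ ((r - 1) * n + j) := by
      rw [pow_add]
      exact hle.trans (Nat.mul_le_mul_right _ hWle)
    have := (Nat.pow_le_pow_iff_right hq1).1 h2
    omega
  refine ⟨z, hz, hz1, ?_, le_antisymm hWle ?_, hmin', fun x hx => ?_⟩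
  · rw [pow_mul, ← hjn', hj]
  · rw [hjn', hrn, pow_add] at hle
    exact Nat.le_of_mul_le_mul_right hle (by positivity)
  · obtain ⟨b, -, hb⟩ := hspan x hx
    exact ⟨b, hb⟩

end PlaceT

section Inertia

variable {Fq : Type} [Field Fq] [Fintype Fq] {q r : ℕ}
  {φ : Polynomial Fq →+* AddMonoid.End (Kbar Fq)}

omit [Fintype Fq] in
theorem abs_const_of_unit {ν : AbsoluteValue (Kbar Fq) ℝ}
    (hunit : ∀ b : Polynomial Fq, ¬ X ∣ b → ν (algebraMap _ _ b) = 1) (c : Fq) (hc : c ≠ 0) :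
    ν (algebraMap (Polynomial Fq) _ (C c)) = 1 :=
  hunit _ (by rwa [X_dvd_iff, coeff_C_zero])

variable (hq : Fintype.card Fq = q) (hr : 1 < r) (hφ : IsDrinfeldPhi Fq q r φ)
  (P : InertiaPlace (RatFunc Fq))
  (hA : ∀ b : Polynomial Fq, P.ν (algebraMap _ _ b) ≤ 1)
  (hunit : ∀ b : Polynomial Fq, ¬ X ∣ b → P.ν (algebraMap _ _ b) = 1)
  (hX : P.ν (algebraMap (Polynomial Fq) _ X) < 1)
include hq hr hφ hA hunit hX

/-- Inertia above `T` acts trivially on torsion modulo integral torsion. -/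
theorem inertia_sub_integral {a : Polynomial Fq} (ha : 0 < a.natDegree) {x : Kbar Fq}
    (hx : φ a x = 0) {σ : Kbar Fq ≃ₐ[RatFunc Fq] Kbar Fq} (hσ : σ ∈ P.H) :
    P.ν (σ x - x) ≤ 1 := by
  have hq1 : 1 < q := hq ▸ Fintype.one_lt_card
  have hC := abs_const_of_unit hunit
  have ha0 : a ≠ 0 := fun h => by rw [h, natDegree_zero] at ha; exact ha.false
  have hT := abs_T_pos P.ν
  have hσA : ∀ b : Polynomial Fq, σ (algebraMap _ _ b) = algebraMap _ _ b := fun b => by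
    rw [IsScalarTower.algebraMap_apply (Polynomial Fq) (RatFunc Fq) (Kbar Fq), σ.commutes]
  obtain ⟨z, hz, hz1, -, -, hmin, hgen⟩ :=
    exists_torsion_generator hq hr hφ P.nonarch hX hC hA hunit ha
  have hσz : P.ν (σ z - z) ≤ 1 := by
    refine hmin _ (by rw [map_sub, phi_equiv hφ, hz, map_zero, sub_zero]) ?_
    obtain ⟨L, -, -, hL, -⟩ := exists_torsion_level hq1 hr hφ P.nonarch hX hC ha0 hz hz1
    have h1 := P.inert σ hσ (algebraMap (Polynomial Fq) _ X * z ^ (q ^ (r - 1)) ^ L)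
      (by rw [map_mul, map_pow, hL])
    rw [map_mul, hσA, map_pow, ← mul_sub, ← pow_mul, ← sub_pow_card_Kbar hq, pow_mul, map_mul,
      map_pow, ← hL] at h1
    exact lt_of_pow_lt_pow_left₀ _ (by positivity) (lt_of_mul_lt_mul_left h1 hT.le)
  obtain ⟨b, hb⟩ := hgen x hx
  have e : σ x - x = (σ (x - φ b z) - (x - φ b z)) + φ b (σ z - z) := by
    rw [map_sub, map_sub, phi_equiv hφ]; ring
  rw [e]
  refine (P.nonarch _ _).trans (max_le (P.inert σ hσ _ hb).le ?_)
  exact abs_phi_le_one hφ P.nonarch hA b hσz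

omit [Fintype Fq] hq hA hunit in
/-- The absolute value of the nonzero integral `T`-torsion points above `T`. -/
theorem abs_T_torsion {x : Kbar Fq} (hq : 1 < q) (hx : φ X x = 0) (hx1 : P.ν x ≤ 1) (hx0 : x ≠ 0) :
    P.ν x ^ (q ^ (r - 1) - 1) = P.ν (algebraMap (Polynomial Fq) _ X) := by
  have hpos := P.ν.pos hx0
  have hT := abs_T_pos P.ν
  have hQ : 0 < q ^ (r - 1) := by positivity
  have h1 : P.ν (x ^ q ^ (r - 1) + algebraMap (Polynomial Fq) _ X ^ (q - 1) * x ^ q ^ r) =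
      P.ν (x ^ q ^ (r - 1)) := by
    refine P.nonarch.add_eq_left_of_lt ?_
    rw [pow_card_pow_eq hr, map_mul, map_pow, map_pow, map_pow]
    set y := P.ν x ^ q ^ (r - 1) with hy
    have hy0 : 0 < y := by positivity
    have hy1 : y ≤ 1 := pow_le_one₀ hpos.le hx1
    calc _ ≤ P.ν (algebraMap (Polynomial Fq) _ X) ^ (q - 1) * y := by
          gcongr
          exact pow_le_of_le_one hy0.le hy1 (by omega)
      _ < y := mul_lt_of_lt_one_left hy0 (pow_lt_one₀ hT.le hX (by omega))
  have h2 : x ^ q ^ (r - 1) + algebraMap (Polynomial Fq) _ X ^ (q - 1) * x ^ q ^ r =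
      - (algebraMap (Polynomial Fq) _ X * x) := by
    rw [phi_X hφ] at hx
    linear_combination hx
  rw [h2, P.ν.map_neg, map_mul, map_pow, ← Nat.sub_add_cancel hQ, pow_succ] at h1
  exact mul_right_cancel₀ hpos.ne' h1.symm

end Inertia

section Wild

variable {Fq : Type} [Field Fq] [Fintype Fq] {q r : ℕ}
  {φ : Polynomial Fq →+* AddMonoid.End (Kbar Fq)}

/-- A suitably ramified place above `T` whose inertia acts on the `a`-torsion through a full
group of transvections. -/
theorem exists_wild_inertia (hq : Fintype.card Fq = q) (hr : 1 < r) (hφ : IsDrinfeldPhi Fq q r φ)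
    {a : Polynomial Fq} (ha : 0 < a.natDegree) (hsq : Squarefree a) :
    ∃ P : InertiaPlace (RatFunc Fq), (∀ b : Polynomial Fq, P.ν (algebraMap _ _ b) ≤ 1) ∧
      (∀ b : Polynomial Fq, ¬ X ∣ b → P.ν (algebraMap _ _ b) = 1) ∧
      P.ν (algebraMap (Polynomial Fq) _ X) < 1 ∧
      ∃ z, φ a z = 0 ∧ (∀ x, φ a x = 0 → ∃ b : Polynomial Fq, P.ν (x - φ b z) ≤ 1) ∧
        ∀ w, φ a w = 0 → P.ν w ≤ 1 → ∃ σ : Kbar Fq ≃ₐ[RatFunc Fq] Kbar Fq,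
          (∀ x, φ a x = 0 → P.ν x ≤ 1 → σ x = x) ∧ σ z = z + w := by
  have hq1 : 1 < q := hq ▸ Fintype.one_lt_card
  have hQ1 : 1 < q ^ (r - 1) := Nat.one_lt_pow (by omega) hq1
  have ha0 : a ≠ 0 := fun h => by rw [h, natDegree_zero] at ha; exact ha.false
  obtain ⟨P, hA, hunit, hPX, hy⟩ := exists_finitePlace (Fq := Fq) irreducible_X
    (e := q ^ (r - 1) - 1) (by omega)
  obtain ⟨y, hys, hyfix⟩ := hy rfl
  have hX : P.ν (algebraMap (Polynomial Fq) _ X) < 1 := by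
    rw [hPX]; exact pow_lt_one₀ P.s_pos.le P.s_lt_one (by omega)
  have hC := abs_const_of_unit hunit
  have hTfix : ∀ w, φ X w = 0 → P.ν w ≤ 1 → ∀ σ ∈ P.H, σ w = w := by
    intro w hw hw1 σ hσ
    by_contra hne
    have hnorm : ∀ t, φ X t = 0 → P.ν t ≤ 1 → t ≠ 0 → P.ν t = P.s := fun t ht ht1 ht0 => by
      have := abs_T_torsion hr hφ P hX hq1 ht ht1 ht0
      rw [hPX] at this
      exact (pow_left_inj₀ (by positivity) P.s_pos.le (by omega)).1 this
    have hw0 : w ≠ 0 := by rintro rfl; exact hne (map_zero σ)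
    have hws := hnorm w hw hw1 hw0
    have hy0 : 0 < P.ν y := hys ▸ P.s_pos
    have h1 := P.inert σ hσ (w / y) (by rw [map_div₀, hws, hys, div_self P.s_pos.ne'])
    rw [map_div₀, hyfix σ hσ, ← sub_div, map_div₀, div_lt_one hy0, hys] at h1
    exact h1.ne (hnorm _ (by rw [map_sub, phi_equiv hφ, hw, map_zero, sub_zero])
      (h1.le.trans P.s_lt_one.le) (sub_ne_zero.2 hne))
  have hfix : ∀ σ ∈ P.H, ∀ x, φ a x = 0 → P.ν x ≤ 1 → σ x = x := by
    intro σ hσ x hx hx1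
    by_cases hXa : X ∣ a
    · obtain ⟨b, rfl⟩ := hXa
      have hXb : ¬ X ∣ b := fun ⟨c, hc⟩ =>
        irreducible_X.not_isUnit (hsq X ⟨c, by rw [hc, mul_assoc]⟩)
      obtain ⟨u, v, huv⟩ := (irreducible_X (R := Fq)).coprime_iff_not_dvd.2 hXb
      have hdec : x = φ (u * X) x + φ (v * b) x := by
        rw [← phi_add_apply, huv, phi_one_apply]
      have h1 : φ b (φ (u * X) x) = 0 := by
        rw [← phi_mul_apply, show b * (u * X) = u * (X * b) by ring, phi_mul_apply, hx, map_zero]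
      have h2 : φ X (φ (v * b) x) = 0 := by
        rw [← phi_mul_apply, show X * (v * b) = v * (X * b) by ring, phi_mul_apply, hx, map_zero]
      rw [hdec, map_add, hTfix _ h2 (abs_phi_le_one hφ P.nonarch hA _ hx1) σ hσ,
        inertia_fixes_torsion hq hr hφ P hA (hunit b hXb) h1
          (abs_phi_le_one hφ P.nonarch hA _ hx1) hσ]
    · exact inertia_fixes_torsion hq hr hφ P hA (hunit a hXa) hx hx1 hσ
  obtain ⟨z, hz, hz1, hzN, hWcard, -, hgen⟩ :=
    exists_torsion_generator hq hr hφ P.nonarch hX hC hA hunit ha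
  refine ⟨P, hA, hunit, hX, z, hz, hgen, fun w hw hw1 => ?_⟩
  set N := q ^ ((r - 1) * a.natDegree) with hN
  have hz0 : z ≠ 0 := by rintro rfl; rw [map_zero] at hz1; exact absurd hz1 (by norm_num)
  obtain ⟨hD, m, hm⟩ := P.orbit z (separable_minpoly_torsion hq hr hφ ha0 hz) hz0
  set D := ((fun σ : Kbar Fq ≃ₐ[RatFunc Fq] Kbar Fq => σ z) '' P.H).ncard
  have hfinW : {x | φ a x = 0 ∧ P.ν x ≤ 1}.Finite :=
    (finite_torsion hq hr hφ ha0).subset fun x hx => hx.1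
  have hsub : (fun σ : Kbar Fq ≃ₐ[RatFunc Fq] Kbar Fq => σ z) '' P.H ⊆
      (fun x => z + x) '' {x | φ a x = 0 ∧ P.ν x ≤ 1} := by
    rintro _ ⟨σ, hσ, rfl⟩
    exact ⟨σ z - z, ⟨by rw [map_sub, phi_equiv hφ, hz, map_zero, sub_zero],
      inertia_sub_integral hq hr hφ P hA hunit hX ha hz hσ⟩, by simp⟩
  have hdvd : N ∣ D := by
    have h1 : P.s ^ (m * N + ((q ^ (r - 1) - 1 : ℕ) : ℤ) * D) = P.s ^ (0 : ℤ) := by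
      rw [zpow_add₀ P.s_pos.ne', zpow_mul, ← hm, zpow_mul, zpow_natCast, zpow_natCast,
        zpow_natCast, ← hPX, zpow_zero, ← pow_mul, mul_comm D N, pow_mul, ← mul_pow,
        mul_comm, hzN, one_pow]
    have h2 := (zpow_right_inj₀ P.s_pos P.s_lt_one.ne).1 h1
    have h3 : (N : ℤ) ∣ ((q ^ (r - 1) - 1 : ℕ) : ℤ) * D := ⟨-m, by linarith⟩
    have h4 : N ∣ (q ^ (r - 1) - 1) * D := by exact_mod_cast h3
    refine Nat.Coprime.dvd_of_dvd_mul_left ?_ h4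
    rw [hN, pow_mul]
    refine Nat.Coprime.pow_left _ ?_
    rw [Nat.coprime_self_sub_right hQ1.le]
    exact Nat.coprime_one_right _
  have hinj : ((fun x => z + x) '' {x | φ a x = 0 ∧ P.ν x ≤ 1}).ncard = N := by
    rw [Set.ncard_image_of_injective _ (add_right_injective z), hWcard]
  have heq := Set.eq_of_subset_of_ncard_le hsub (by rw [hinj]; exact Nat.le_of_dvd hD hdvd)
    (hfinW.image _)
  obtain ⟨σ, hσ, hσz⟩ := heq.symm.subset ⟨w, ⟨hw, hw1⟩, rfl⟩
  exact ⟨σ, hfix σ hσ, hσz⟩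

end Wild

section Transvections

variable {Fq : Type} [Field Fq] [Fintype Fq] {q r : ℕ}
  {φ : Polynomial Fq →+* AddMonoid.End (Kbar Fq)}

/-- Inertia above `T` realises all transvections of the `l₁`-torsion along the integral part,
while acting trivially on the `l₂`-torsion. -/
theorem exists_transvections (hq : Fintype.card Fq = q) (hr : 1 < r) (hφ : IsDrinfeldPhi Fq q r φ)
    {l₁ l₂ : Polynomial Fq} (h₁ : Irreducible l₁) (h₂ : Irreducible l₂) (h : IsCoprime l₁ l₂) :
    ∃ P : InertiaPlace (RatFunc Fq), (∀ b : Polynomial Fq, P.ν (algebraMap _ _ b) ≤ 1) ∧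
      (∀ b : Polynomial Fq, ¬ X ∣ b → P.ν (algebraMap _ _ b) = 1) ∧
      P.ν (algebraMap (Polynomial Fq) _ X) < 1 ∧
      ∃ z, φ l₁ z = 0 ∧ 1 < P.ν z ∧
        (∀ x, φ l₁ x = 0 → ∃ b : Polynomial Fq, P.ν (x - φ b z) ≤ 1) ∧
        ∀ w, φ l₁ w = 0 → P.ν w ≤ 1 → ∃ σ : Kbar Fq ≃ₐ[RatFunc Fq] Kbar Fq,
          (∀ x, φ l₁ x = 0 → P.ν x ≤ 1 → σ x = x) ∧ σ z = z + w ∧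
          ∀ x, φ l₂ x = 0 → σ x = x := by
  have hne := mul_ne_zero h₁.ne_zero h₂.ne_zero
  have hd₁ : 0 < l₁.natDegree := h₁.natDegree_pos
  have hsq : Squarefree (l₁ * l₂) :=
    (squarefree_mul_iff).2 ⟨h.isRelPrime, h₁.squarefree, h₂.squarefree⟩
  obtain ⟨P, hA, hunit, hX, z, hz, hgen, hσ⟩ := exists_wild_inertia hq hr hφ
    (a := l₁ * l₂) (by rw [natDegree_mul h₁.ne_zero h₂.ne_zero]; omega) hsq
  obtain ⟨u, v, huv⟩ := h
  have tor₁ : ∀ x, φ l₁ x = 0 → φ (l₁ * l₂) x = 0 := fun x hx => by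
    rw [mul_comm, phi_mul_apply, hx, map_zero]
  have tor₂ : ∀ x, φ l₂ x = 0 → φ (l₁ * l₂) x = 0 := fun x hx => by
    rw [phi_mul_apply, hx, map_zero]
  have id₁ : ∀ x, φ l₁ x = 0 → φ (v * l₂) x = x := fun x hx => by
    have := phi_add_apply φ (u * l₁) (v * l₂) x
    rw [huv, phi_one_apply, phi_mul_apply φ u, hx, map_zero, zero_add] at this
    exact this.symm
  have id₂ : ∀ x, φ l₂ x = 0 → φ (u * l₁) x = x := fun x hx => by
    have := phi_add_apply φ (u * l₁) (v * l₂) x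
    rw [huv, phi_one_apply, phi_mul_apply φ v, hx, map_zero, add_zero] at this
    exact this.symm
  have hgen₁ : ∀ x, φ l₁ x = 0 → ∃ b : Polynomial Fq, P.ν (x - φ b (φ (v * l₂) z)) ≤ 1 := by
    intro x hx
    obtain ⟨b, hb⟩ := hgen x (tor₁ x hx)
    refine ⟨b, ?_⟩
    have := abs_phi_le_one hφ P.nonarch hA (v * l₂) hb
    rwa [map_sub, id₁ x hx, phi_comm] at this
  refine ⟨P, hA, hunit, hX, φ (v * l₂) z, ?_, ?_, hgen₁, ?_⟩
  · rw [← phi_mul_apply, show l₁ * (v * l₂) = v * (l₁ * l₂) by ring, phi_mul_apply, hz, map_zero]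
  · by_contra! hz1
    obtain ⟨z', hz', hz'1, -⟩ := exists_torsion_generator hq hr hφ P.nonarch hX
      (abs_const_of_unit hunit) hA hunit hd₁
    obtain ⟨b, hb⟩ := hgen₁ z' hz'
    have := P.nonarch (z' - φ b (φ (v * l₂) z)) (φ b (φ (v * l₂) z))
    rw [sub_add_cancel] at this
    exact absurd hz'1 (this.trans (max_le hb (abs_phi_le_one hφ P.nonarch hA b hz1))).not_gt
  · intro w hw hw1
    obtain ⟨σ, hfix, hσz⟩ := hσ w (tor₁ w hw) hw1
    refine ⟨σ, fun x hx => hfix x (tor₁ x hx), ?_, fun x hx => ?_⟩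
    · rw [← phi_equiv hφ, hσz, map_add, id₁ w hw]
    · obtain ⟨b, hb⟩ := hgen x (tor₂ x hx)
      have h3 := hfix (φ (u * l₁) (x - φ b z))
        (by rw [phi_comm, map_sub, tor₂ x hx, phi_comm, hz, map_zero, sub_zero, map_zero])
        (abs_phi_le_one hφ P.nonarch hA _ hb)
      have h4 : φ (u * l₁) w = 0 := by rw [phi_mul_apply, hw, map_zero]
      rw [← phi_equiv hφ, map_sub σ, ← phi_equiv hφ σ b, hσz, map_sub, map_sub, map_add, map_add,
        phi_comm φ (u * l₁) b w, h4, map_zero, add_zero, sub_left_inj, phi_equiv hφ,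
        id₂ x hx] at h3
      exact h3

end Transvections

section Irreducibility

variable {Fq : Type} [Field Fq] {q r : ℕ}
  {φ : Polynomial Fq →+* AddMonoid.End (Kbar Fq)}

/-- Nonzero torsion points have absolute value less than one at infinity. -/
theorem abs_infinite_torsion_lt_one (hq : 2 < q) (hr : 1 < r) (hφ : IsDrinfeldPhi Fq q r φ)
    {ν : AbsoluteValue (Kbar Fq) ℝ} (hν : IsNonarchimedean ν) {R : ℝ} (hR : 1 < R)
    (hdeg : ∀ b : Polynomial Fq, b ≠ 0 → ν (algebraMap _ _ b) = R ^ b.natDegree)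
    {a : Polynomial Fq} (ha : a ≠ 0) {x : Kbar Fq} (hx : φ a x = 0) : ν x < 1 := by
  have hX : ν (algebraMap (Polynomial Fq) _ X) = R := by rw [hdeg X X_ne_zero]; simp
  have step : ∀ t, 1 ≤ ν t → ν t < ν (φ X t) := by
    intro t ht
    have hle : ∀ {i j : ℕ}, i ≤ j → ν t ^ i ≤ ν t ^ j := fun h => pow_le_pow_right₀ ht h
    have hqr : 1 ≤ q ^ r := Nat.one_le_pow _ _ (by omega)
    have hR' : R < R ^ (q - 1) := by
      simpa using pow_lt_pow_right₀ hR (by omega : 1 < q - 1)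
    have h1 : ν (algebraMap (Polynomial Fq) _ X * t) <
        ν (algebraMap (Polynomial Fq) _ X ^ (q - 1) * t ^ q ^ r) := by
      rw [map_mul, map_mul, map_pow, map_pow, hX]
      have h5 : ν t ≤ ν t ^ q ^ r := by simpa using hle hqr
      have h6 : 0 < ν t := by linarith
      calc R * ν t < R ^ (q - 1) * ν t := by gcongr
        _ ≤ _ := by gcongr
    have h2 : ν (t ^ q ^ (r - 1)) < ν (algebraMap (Polynomial Fq) _ X ^ (q - 1) * t ^ q ^ r) := by
      rw [map_mul, map_pow, map_pow, map_pow, hX]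
      calc ν t ^ q ^ (r - 1) ≤ 1 * ν t ^ q ^ r := by
            rw [one_mul]; exact hle (Nat.pow_le_pow_right (by omega) (by omega))
        _ < R ^ (q - 1) * ν t ^ q ^ r := by
            gcongr
            exact one_lt_pow₀ hR (by omega)
    rw [phi_X hφ, hν.add_eq_right_of_lt ((hν _ _).trans_lt (max_lt h1 h2))]
    refine lt_of_le_of_lt ?_ h1
    rw [map_mul, hX]
    exact le_mul_of_one_le_left (by positivity) hR.le
  by_contra! h1
  have key : ∀ i, 1 ≤ ν (φ (X ^ i) x) := by
    intro i
    induction i with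
    | zero => rwa [pow_zero, phi_one_apply]
    | succ i ih => rw [pow_succ', phi_mul_apply]; exact ih.trans (step _ ih).le
  refine (abs_phi_of_strictly_increasing hφ hν (fun c hc => ?_) ha (x := x) ?_ fun i _ => ?_).2 hx
  · rw [hdeg _ (C_ne_zero.2 hc), natDegree_C, pow_zero]
  · rintro rfl
    rw [map_zero] at h1
    exact absurd h1 (by norm_num)
  · rw [pow_succ', phi_mul_apply]
    exact step _ (key i)

/-- A rational function which is integral at all finite places is a polynomial. -/
theorem exists_polynomial_of_integral (c : RatFunc Fq)
    (h : ∀ l : Polynomial Fq, Irreducible l → (l = X ∨ ¬ l ∣ X) →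
      ∃ ν : AbsoluteValue (Kbar Fq) ℝ, (∀ b, ¬ l ∣ b → ν (algebraMap (Polynomial Fq) _ b) = 1) ∧
        ν (algebraMap (Polynomial Fq) _ l) < 1 ∧
        (∀ b : Polynomial Fq, ν (algebraMap _ _ b) ≤ 1) ∧
        ν (algebraMap (RatFunc Fq) (Kbar Fq) c) ≤ 1) :
    ∃ b : Polynomial Fq, algebraMap _ _ b = c := by
  by_cases hd : IsUnit c.denom
  · have h1 : c.denom = 1 := (c.monic_denom).eq_one_of_isUnit hd
    refine ⟨c.num, ?_⟩
    have := c.num_div_denom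
    rwa [h1, map_one, div_one] at this
  · exfalso
    obtain ⟨l, hl, hlX, hld⟩ : ∃ l : Polynomial Fq, Irreducible l ∧ (l = X ∨ ¬ l ∣ X) ∧
        l ∣ c.denom := by
      by_cases hX : X ∣ c.denom
      · exact ⟨X, irreducible_X, Or.inl rfl, hX⟩
      · obtain ⟨l, hl, hld⟩ := WfDvdMonoid.exists_irreducible_factor hd c.denom_ne_zero
        exact ⟨l, hl, Or.inr fun h3 =>
          hX (((hl.associated_of_dvd irreducible_X h3).dvd_iff_dvd_left).1 hld), hld⟩
    obtain ⟨ν, hunit, hl1, hA, hc⟩ := h l hl hlX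
    have hnum : ¬ l ∣ c.num := fun h3 =>
      hl.not_isUnit (c.isCoprime_num_denom.isUnit_of_dvd' h3 hld)
    have hden : ν (algebraMap (Polynomial Fq) _ c.denom) < 1 := by
      obtain ⟨b, hb⟩ := hld
      rw [hb, map_mul, map_mul]
      exact mul_lt_one_of_nonneg_of_lt_one_left (by positivity) hl1 (hA b)
    have e : algebraMap (RatFunc Fq) (Kbar Fq) c * algebraMap (Polynomial Fq) _ c.denom =
        algebraMap (Polynomial Fq) _ c.num := by
      rw [IsScalarTower.algebraMap_apply (Polynomial Fq) (RatFunc Fq) (Kbar Fq),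
        IsScalarTower.algebraMap_apply (Polynomial Fq) (RatFunc Fq) (Kbar Fq), ← map_mul]
      congr 1
      have h0 : algebraMap (Polynomial Fq) (RatFunc Fq) c.denom ≠ 0 := by
        simpa using c.denom_ne_zero
      have h5 := c.num_div_denom
      rw [div_eq_iff h0] at h5
      exact h5.symm
    have h4 := congrArg ν e
    rw [map_mul, hunit _ hnum] at h4
    exact absurd h4 (mul_lt_one_of_nonneg_of_lt_one_right hc (by positivity) hden).ne

/-- Every nonzero torsion point has a conjugate which is not integral at a given place
above `T`. -/
theorem exists_conj_not_integral [Finite Fq] (hq2 : 2 < q)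
    (hr : 1 < r) (hφ : IsDrinfeldPhi Fq q r φ) {ν : AbsoluteValue (Kbar Fq) ℝ}
    (hA : ∀ b : Polynomial Fq, ν (algebraMap _ _ b) ≤ 1)
    (hunit : ∀ b : Polynomial Fq, ¬ X ∣ b → ν (algebraMap _ _ b) = 1)
    (hX : ν (algebraMap (Polynomial Fq) _ X) < 1)
    {a : Polynomial Fq} (ha : a ≠ 0) {u : Kbar Fq} (hu : φ a u = 0) (hu0 : u ≠ 0) :
    ∃ σ : Kbar Fq ≃ₐ[RatFunc Fq] Kbar Fq, 1 < ν (σ u) := by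
  by_contra! hcon
  have h_integral : IsIntegral (RatFunc Fq) u := Algebra.IsIntegral.isIntegral u
  set m := minpoly (RatFunc Fq) u with hm
  have hroots : ∀ y ∈ m.aroots (Kbar Fq), φ a y = 0 ∧ ν y ≤ 1 := by
    intro y hy
    have hy' : aeval y m = 0 := (mem_aroots.1 hy).2
    obtain ⟨σ, hσ⟩ := isConjRoot_iff_exists_algEquiv.1
      ((isConjRoot_iff_aeval_eq_zero h_integral).2 hy').symm
    rw [← hσ, phi_equiv hφ, hu, map_zero]
    exact ⟨rfl, hcon σ⟩
  have hc0 : m.coeff 0 ≠ 0 := minpoly.coeff_zero_ne_zero h_integral hu0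
  have habs : ∀ ν' : AbsoluteValue (Kbar Fq) ℝ, ν' (algebraMap (RatFunc Fq) (Kbar Fq) (m.coeff 0)) =
      ((m.aroots (Kbar Fq)).map ν').prod := by
    intro ν'
    have h1 := (IsAlgClosed.splits (m.map (algebraMap (RatFunc Fq) (Kbar Fq)))).coeff_zero_eq_prod_roots_of_monic
      ((minpoly.monic h_integral).map _)
    rw [coeff_map] at h1
    rw [h1, map_mul, map_pow, ν'.map_neg, map_one, one_pow, one_mul, map_multiset_prod]
  have hle : ∀ ν' : AbsoluteValue (Kbar Fq) ℝ, (∀ y ∈ m.aroots (Kbar Fq), ν' y ≤ 1) →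
      ν' (algebraMap (RatFunc Fq) (Kbar Fq) (m.coeff 0)) ≤ 1 := by
    intro ν' h
    rw [habs]
    refine Multiset.prod_induction (fun t : ℝ => 0 ≤ t ∧ t ≤ 1) _
      (fun s t hs ht => ⟨mul_nonneg hs.1 ht.1, mul_le_one₀ hs.2 ht.1 ht.2⟩)
      ⟨zero_le_one, le_rfl⟩ ?_ |>.2
    intro t ht
    obtain ⟨y, hy, rfl⟩ := Multiset.mem_map.1 ht
    exact ⟨by positivity, h y hy⟩
  obtain ⟨b, hb⟩ := exists_polynomial_of_integral (m.coeff 0) (by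
    rintro l hl (rfl | hlX)
    · exact ⟨ν, hunit, hX, hA, hle ν fun y hy => (hroots y hy).2⟩
    · obtain ⟨P, hPA, hPu, hPl, -⟩ := exists_finitePlace (Fq := Fq) hl one_pos
      refine ⟨P.ν, hPu, by rw [hPl, pow_one]; exact P.s_lt_one, hPA, hle _ fun y hy => ?_⟩
      refine abs_torsion_le_one (by omega) hr hφ P.nonarch hPA (hPu _ hlX)
        (fun c hc => hPu _ fun h => ?_) ha (hroots y hy).1
      exact hl.not_isUnit (isUnit_of_dvd_unit h (isUnit_C.2 hc.isUnit)))
  have hb0 : b ≠ 0 := by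
    rintro rfl
    rw [map_zero] at hb
    exact hc0 hb.symm
  obtain ⟨P, R, hR, hdeg⟩ := exists_infinitePlace (Fq := Fq)
  have h1 : 1 ≤ P.ν (algebraMap (RatFunc Fq) (Kbar Fq) (m.coeff 0)) := by
    rw [← hb, ← IsScalarTower.algebraMap_apply, hdeg b hb0]
    exact one_le_pow₀ hR.le
  have hmem : u ∈ m.aroots (Kbar Fq) := mem_aroots.2 ⟨minpoly.ne_zero h_integral, minpoly.aeval _ _⟩
  obtain ⟨s, hs⟩ := Multiset.exists_cons_of_mem hmem
  have hlt : ∀ y ∈ m.aroots (Kbar Fq), P.ν y < 1 := fun y hy =>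
    abs_infinite_torsion_lt_one hq2 hr hφ P.nonarch hR hdeg ha (hroots y hy).1
  rw [habs, hs, Multiset.map_cons, Multiset.prod_cons] at h1
  rw [hs] at hlt
  have h2 : (s.map P.ν).prod ≤ 1 := by
    refine Multiset.prod_induction (fun t : ℝ => 0 ≤ t ∧ t ≤ 1) _
      (fun s t hs ht => ⟨mul_nonneg hs.1 ht.1, mul_le_one₀ hs.2 ht.1 ht.2⟩)
      ⟨zero_le_one, le_rfl⟩ ?_ |>.2
    intro t ht
    obtain ⟨y, hy, rfl⟩ := Multiset.mem_map.1 ht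
    exact ⟨by positivity, (hlt y (Multiset.mem_cons_of_mem hy)).le⟩
  have h3 := hlt u (Multiset.mem_cons_self _ _)
  have h4 : P.ν u * (s.map P.ν).prod ≤ P.ν u := mul_le_of_le_one_right (by positivity) h2
  exact absurd h1 (by linarith [h4.trans_lt h3])

end Irreducibility

section TorsionModule

variable {Fq : Type} [Field Fq] {q r : ℕ}

/-- The group of `l`-torsion points. -/
def torsionSub (φ : Polynomial Fq →+* AddMonoid.End (Kbar Fq)) (l : Polynomial Fq) :
    AddSubgroup (Kbar Fq) := AddMonoidHom.ker (φ l)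

theorem mem_torsionSub {φ : Polynomial Fq →+* AddMonoid.End (Kbar Fq)} {l : Polynomial Fq}
    {x : Kbar Fq} : x ∈ torsionSub φ l ↔ φ l x = 0 := Iff.rfl

/-- The action of polynomials on the `l`-torsion. -/
def torsionAction (φ : Polynomial Fq →+* AddMonoid.End (Kbar Fq)) (l : Polynomial Fq) :
    Polynomial Fq →+* AddMonoid.End (torsionSub φ l) where
  toFun b := ((φ b).comp (torsionSub φ l).subtype).codRestrict _ fun x => by
    change φ l (φ b x) = 0
    rw [phi_comm, mem_torsionSub.1 x.2, map_zero]
  map_one' := by ext x; exact phi_one_apply φ (x : Kbar Fq)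
  map_mul' a b := by ext x; exact phi_mul_apply φ a b (x : Kbar Fq)
  map_zero' := by ext x; exact phi_zero_apply φ (x : Kbar Fq)
  map_add' a b := by ext x; exact phi_add_apply φ a b (x : Kbar Fq)

theorem torsionAction_apply (φ : Polynomial Fq →+* AddMonoid.End (Kbar Fq)) (l b : Polynomial Fq)
    (x : torsionSub φ l) : ((torsionAction φ l b x : torsionSub φ l) : Kbar Fq) = φ b x := rfl

/-- The action of `A / (l)` on the `l`-torsion. -/
def torsionActionQuot (φ : Polynomial Fq →+* AddMonoid.End (Kbar Fq)) (l : Polynomial Fq) :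
    AdjoinRoot l →+* AddMonoid.End (torsionSub φ l) :=
  Ideal.Quotient.lift _ (torsionAction φ l) fun b hb => by
    obtain ⟨c, rfl⟩ := Ideal.mem_span_singleton.1 hb
    ext x
    rw [torsionAction_apply, mul_comm, phi_mul_apply, mem_torsionSub.1 x.2, map_zero]
    rfl

instance torsionModule (φ : Polynomial Fq →+* AddMonoid.End (Kbar Fq)) (l : Polynomial Fq) :
    Module (AdjoinRoot l) (torsionSub φ l) :=
  Module.compHom _ (torsionActionQuot φ l)

theorem coe_mk_smul (φ : Polynomial Fq →+* AddMonoid.End (Kbar Fq)) (l b : Polynomial Fq)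
    (x : torsionSub φ l) : ((AdjoinRoot.mk l b • x : torsionSub φ l) : Kbar Fq) = φ b x := rfl

theorem finite_adjoinRoot [Finite Fq] {l : Polynomial Fq} (hl : l ≠ 0) : Finite (AdjoinRoot l) := by
  have := (AdjoinRoot.powerBasis hl).finite
  exact Module.finite_of_finite Fq

/-- The Galois action on the `l`-torsion. -/
def torsionRep {φ : Polynomial Fq →+* AddMonoid.End (Kbar Fq)} (hφ : IsDrinfeldPhi Fq q r φ)
    (l : Polynomial Fq) : (Kbar Fq ≃ₐ[RatFunc Fq] Kbar Fq) →*
      (torsionSub φ l ≃ₗ[AdjoinRoot l] torsionSub φ l) where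
  toFun σ :=
    { toFun x := ⟨σ x, by rw [mem_torsionSub, phi_equiv hφ, mem_torsionSub.1 x.2, map_zero]⟩
      invFun x := ⟨σ.symm x, by rw [mem_torsionSub, phi_equiv hφ, mem_torsionSub.1 x.2, map_zero]⟩
      left_inv x := Subtype.ext (σ.symm_apply_apply _)
      right_inv x := Subtype.ext (σ.apply_symm_apply _)
      map_add' x y := Subtype.ext (map_add σ _ _)
      map_smul' c x := by
        obtain ⟨b, rfl⟩ := AdjoinRoot.mk_surjective c
        refine Subtype.ext ?_
        simp only [coe_mk_smul, RingHom.id_apply]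
        exact (phi_equiv hφ σ b x).symm }
  map_one' := rfl
  map_mul' _ _ := rfl

theorem coe_torsionRep {φ : Polynomial Fq →+* AddMonoid.End (Kbar Fq)}
    (hφ : IsDrinfeldPhi Fq q r φ) (l : Polynomial Fq) (σ : Kbar Fq ≃ₐ[RatFunc Fq] Kbar Fq)
    (x : torsionSub φ l) : (torsionRep hφ l σ x : Kbar Fq) = σ x := rfl

theorem finite_torsionSub [Fintype Fq] (hq : Fintype.card Fq = q) (hr : 1 < r)
    {φ : Polynomial Fq →+* AddMonoid.End (Kbar Fq)} (hφ : IsDrinfeldPhi Fq q r φ)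
    {l : Polynomial Fq} (hl : l ≠ 0) : Finite (torsionSub φ l) :=
  finite_torsion hq hr hφ hl

end TorsionModule

section Determinant

variable {κ V : Type*} [Field κ] [AddCommGroup V] [Module κ V] [FiniteDimensional κ V]

/-- An endomorphism acting trivially modulo a submodule has the determinant of its
restriction. -/
theorem det_eq_det_restrict (e : V →ₗ[κ] V) (W : Submodule κ V) (h : ∀ v, e v - v ∈ W)
    (hW : ∀ w ∈ W, e w ∈ W) : LinearMap.det e = LinearMap.det (e.restrict hW) := by
  rw [LinearMap.det_eq_det_mul_det W e hW]
  have : W.mapQ W e hW = LinearMap.id := by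
    ext v
    simpa [Submodule.Quotient.eq] using h v
  rw [this, LinearMap.det_id, mul_one]

theorem det_eq_one_of_unipotent (e : V →ₗ[κ] V) (h : ∀ v, e (e v - v) = e v - v) :
    LinearMap.det e = 1 := by
  have hW : ∀ w ∈ LinearMap.ker (e - LinearMap.id), e w ∈ LinearMap.ker (e - LinearMap.id) := by
    intro w hw
    rw [LinearMap.mem_ker, LinearMap.sub_apply, LinearMap.id_apply, sub_eq_zero] at hw ⊢
    rw [hw, hw]
  rw [det_eq_det_restrict e _ (fun v => by simpa [sub_eq_zero] using h v) hW]
  have : e.restrict hW = LinearMap.id := by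
    ext ⟨w, hw⟩
    rw [LinearMap.mem_ker, LinearMap.sub_apply, LinearMap.id_apply, sub_eq_zero] at hw
    exact hw
  rw [this, LinearMap.det_id]

/-- If a finite vector space is identified with a multiplicatively closed subset of a domain,
then multiplications attain all nonzero determinants. -/
theorem exists_det_eq {W k : Type*} [AddCommGroup W] [Module κ W] [Finite W] [Finite κ]
    [CommRing k] [IsDomain k] (j : κ →+* k) (ξ : W →+ k) (hinj : Function.Injective ξ)
    (hsmul : ∀ c w, ξ (c • w) = j c * ξ w) {w₀ : W} (h₀ : ξ w₀ = 1)
    (hmul : ∀ v w, ∃ u, ξ u = ξ v * ξ w) {b : κ} (hb : b ≠ 0) :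
    ∃ w : W, w ≠ 0 ∧ ∀ g : W →ₗ[κ] W, (∀ v, ξ (g v) = ξ v * ξ w) → LinearMap.det g = b := by
  let K : Subring k :=
    { ξ.range with
      mul_mem' := by
        rintro _ _ ⟨v, rfl⟩ ⟨w, rfl⟩
        exact hmul v w
      one_mem' := ⟨w₀, h₀⟩ }
  have hK : ∀ w, ξ w ∈ K := fun w => ⟨w, rfl⟩
  have : Finite K := Finite.of_surjective (fun w : W => (⟨ξ w, hK w⟩ : K)) (by
    rintro ⟨_, w, rfl⟩
    exact ⟨w, rfl⟩)
  let _ : Fintype K := Fintype.ofFinite K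
  let _ : Field K := (Finite.isField_of_domain K).toField
  let _ : Algebra κ K := (j.codRestrict K fun c => by
    simpa [hsmul, h₀] using hK (c • w₀)).toAlgebra
  have halg : ∀ (c : κ) (y : K), ((c • y : K) : k) = j c * y := fun c y => by
    rw [Algebra.smul_def]; rfl
  let e : W ≃ₗ[κ] K := LinearEquiv.ofBijective
    { toFun w := ⟨ξ w, hK w⟩
      map_add' v w := Subtype.ext (map_add ξ v w)
      map_smul' c w := Subtype.ext (by rw [RingHom.id_apply, halg]; exact hsmul c w) }
    ⟨fun v w h => hinj (congrArg Subtype.val h), by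
      rintro ⟨_, w, rfl⟩
      exact ⟨w, rfl⟩⟩
  have he : ∀ w, ((e w : K) : k) = ξ w := fun w => rfl
  obtain ⟨y, hy⟩ := FiniteField.norm_surjective κ K b
  refine ⟨e.symm y, ?_, fun g hg => ?_⟩
  · rintro h
    rw [LinearEquiv.map_eq_zero_iff] at h
    rw [h, Algebra.norm_zero] at hy
    exact hb hy.symm
  · rw [← hy, Algebra.norm_apply, ← LinearMap.det_conj g e]
    congr 1
    ext v
    obtain ⟨w, rfl⟩ := e.surjective v
    simp [he, hg]
    rw [← he (e.symm y), e.apply_symm_apply, mul_comm]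

end Determinant

section Tame

theorem InertiaPlace.orbit_eq {F : Type} [Field F] (P : InertiaPlace F) {x : AlgebraicClosure F}
    (hsep : (minpoly F x).Separable) (hx : x ≠ 0) {n : ℕ} (hn : P.ν x ^ n = P.s)
    {S : Set (AlgebraicClosure F)} (hS : S.Finite) (hcard : S.ncard ≤ n)
    (horb : ∀ σ ∈ P.H, σ x ∈ S) {y : AlgebraicClosure F} (hy : y ∈ S) : ∃ σ ∈ P.H, σ x = y := by
  obtain ⟨hpos, m, hm⟩ := P.orbit x hsep hx
  set O := (fun σ : AlgebraicClosure F ≃ₐ[F] AlgebraicClosure F => σ x) '' P.H with hO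
  have hsub : O ⊆ S := by
    rintro _ ⟨σ, hσ, rfl⟩
    exact horb σ hσ
  have hlt : P.ν x < 1 := by
    by_contra! h
    exact absurd (one_le_pow₀ h (n := n)) (by rw [hn]; exact P.s_lt_one.not_ge)
  have hle : S.ncard ≤ O.ncard := by
    rw [← hn, ← zpow_natCast, ← zpow_natCast, ← zpow_mul] at hm
    have h1 := zpow_right_injective₀ (P.ν.pos hx) hlt.ne hm
    have h2 : n ∣ O.ncard := Int.natCast_dvd_natCast.1 ⟨m, h1⟩
    exact hcard.trans (Nat.le_of_dvd hpos h2)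
  have := Set.eq_of_subset_of_ncard_le hsub hle hS
  rw [← this] at hy
  exact hy

variable {Fq : Type} [Field Fq] [Fintype Fq] {q r : ℕ}
  {φ : Polynomial Fq →+* AddMonoid.End (Kbar Fq)}
  (hq : Fintype.card Fq = q) (hr : 1 < r) (hφ : IsDrinfeldPhi Fq q r φ)
include hq hr hφ

theorem abs_phi_sub_mul_le {ν : AbsoluteValue (Kbar Fq) ℝ} (hν : IsNonarchimedean ν)
    (hA : ∀ b : Polynomial Fq, ν (algebraMap _ _ b) ≤ 1) (b : Polynomial Fq) {x : Kbar Fq}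
    (hx : ν x ≤ 1) : ν (φ b x - algebraMap _ _ b * x) ≤ ν x ^ 2 := by
  have hq1 : 1 < q := hq ▸ Fintype.one_lt_card
  set p := torsionPolyBar Fq q r b with hp
  have h1 : φ b x - algebraMap _ _ b * x = x ^ 2 * p.divX.divX.eval x := by
    have h2 := congrArg (eval x) (divX_mul_X_add p)
    have h3 := congrArg (eval x) (divX_mul_X_add p.divX)
    have h4 : p.divX.coeff 0 = algebraMap _ _ b := by
      rw [coeff_divX]
      exact coeff_torsionPolyBar_one hq hr b
    rw [hp, coeff_torsionPolyBar_zero hq1, ← hp, eval_add, eval_mul, eval_X, eval_C, add_zero, hp,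
      eval_torsionPolyBar hφ, ← hp] at h2
    rw [h4, eval_add, eval_mul, eval_X, eval_C] at h3
    rw [← h2, ← h3]
    ring
  rw [h1, map_mul, map_pow]
  refine mul_le_of_le_one_right (by positivity) (nonarch_eval_le_one hν (fun i => ?_) hx)
  rw [coeff_divX, coeff_divX, hp, coeff_map]
  exact hA _

/-- If inertia at a place acts transitively on the nonzero small torsion points and trivially
modulo these, then it attains all determinants. -/
theorem exists_det_of_transitive {l : Polynomial Fq} [Fact (Irreducible l)]
    (P : InertiaPlace (RatFunc Fq)) (hA : ∀ b : Polynomial Fq, P.ν (algebraMap _ _ b) ≤ 1)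
    (hl : P.ν (algebraMap (Polynomial Fq) _ l) < 1) {w₀ : Kbar Fq} (hw₀ : φ l w₀ = 0) (h₀ : w₀ ≠ 0)
    (hw₁ : P.ν w₀ < 1)
    (htrans : ∀ w, φ l w = 0 → w ≠ 0 → P.ν w < 1 → ∃ σ ∈ P.H, σ w₀ = w)
    (hin : ∀ σ ∈ P.H, ∀ x, φ l x = 0 → P.ν (σ x - x) < 1) {b : AdjoinRoot l} (hb : b ≠ 0) :
    ∃ σ ∈ P.H, LinearMap.det (torsionRep hφ l σ : torsionSub φ l →ₗ[AdjoinRoot l] torsionSub φ l)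
      = b := by
  have hl0 : l ≠ 0 := (Fact.out : Irreducible l).ne_zero
  have hν := P.nonarch
  have hpos := P.ν.pos h₀
  have := finite_torsionSub hq hr hφ hl0
  have := finite_adjoinRoot hl0
  have : FiniteDimensional (AdjoinRoot l) (torsionSub φ l) := Module.Finite.of_finite
  let k := integers hν ⧸ integersIdeal hν
  let W : Submodule (AdjoinRoot l) (torsionSub φ l) :=
    { carrier := {x | P.ν (x : Kbar Fq) < 1}
      add_mem' := fun {x y} hx hy => (hν x y).trans_lt (max_lt hx hy)
      zero_mem' := by simp
      smul_mem' := by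
        intro c x hx
        obtain ⟨b, rfl⟩ := AdjoinRoot.mk_surjective c
        change P.ν (φ b x) < 1
        have hx' : P.ν (x : Kbar Fq) < 1 := hx
        have h1 := abs_phi_sub_mul_le hq hr hφ hν hA b hx'.le
        have h2 : P.ν (algebraMap (Polynomial Fq) _ b * x) < 1 := by
          rw [map_mul]
          exact mul_lt_one_of_nonneg_of_lt_one_right (hA b) (by positivity) hx'
        rw [← sub_add_cancel (φ b x) (algebraMap (Polynomial Fq) _ b * x)]
        exact (hν _ _).trans_lt (max_lt (h1.trans_lt (pow_lt_one₀ (by positivity) hx' two_ne_zero))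
          h2) }
  have hWmem : ∀ x : torsionSub φ l, x ∈ W ↔ P.ν (x : Kbar Fq) < 1 := fun x => Iff.rfl
  have hval : ∀ x : W, P.ν (((x : torsionSub φ l) : Kbar Fq) / w₀) ≤ 1 := by
    intro x
    by_cases hx : ((x : torsionSub φ l) : Kbar Fq) = 0
    · simp [hx]
    · obtain ⟨σ, hσ, h⟩ := htrans _ (x : torsionSub φ l).2 hx x.2
      rw [map_div₀, ← h, P.inv σ hσ, div_self hpos.ne']
  let ξ : W →+ k :=
    { toFun x := Ideal.Quotient.mk _ (⟨((x : torsionSub φ l) : Kbar Fq) / w₀, hval x⟩ : integers hν)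
      map_zero' := by
        rw [Ideal.Quotient.eq_zero_iff_mem, mem_integersIdeal]
        simp
      map_add' x y := by
        rw [← map_add]
        congr 1
        exact Subtype.ext (add_div _ _ _) }
  have hξ : ∀ (x : W) (y : integers hν), P.ν (((x : torsionSub φ l) : Kbar Fq) / w₀ - y) < 1 →
      ξ x = Ideal.Quotient.mk _ y := fun x y h => Ideal.Quotient.eq.2 h
  have hinj : Function.Injective ξ := by
    rw [injective_iff_map_eq_zero]
    intro x hx
    have h1 : P.ν (((x : torsionSub φ l) : Kbar Fq) / w₀) < 1 := Ideal.Quotient.eq_zero_iff_mem.1 hx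
    by_contra hne
    have hx0 : ((x : torsionSub φ l) : Kbar Fq) ≠ 0 := fun h => hne (by ext; exact h)
    obtain ⟨σ, hσ, h⟩ := htrans _ (x : torsionSub φ l).2 hx0 x.2
    rw [map_div₀, ← h, P.inv σ hσ, div_self hpos.ne'] at h1
    exact h1.false
  let j₀ : Polynomial Fq →+* k := (Ideal.Quotient.mk _).comp
    ((algebraMap (Polynomial Fq) (Kbar Fq)).codRestrict (integers hν) hA)
  let j : AdjoinRoot l →+* k := Ideal.Quotient.lift _ j₀ fun b hb => by
    obtain ⟨c, rfl⟩ := Ideal.mem_span_singleton.1 hb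
    refine Ideal.Quotient.eq_zero_iff_mem.2 ?_
    change P.ν (algebraMap (Polynomial Fq) (Kbar Fq) (l * c)) < 1
    rw [map_mul, map_mul]
    exact mul_lt_one_of_nonneg_of_lt_one_left (by positivity) hl (hA c)
  have hsmul : ∀ (c : AdjoinRoot l) (w : W), ξ (c • w) = j c * ξ w := by
    intro c w
    obtain ⟨b, rfl⟩ := AdjoinRoot.mk_surjective c
    refine hξ _ (⟨_, hA b⟩ * ⟨_, hval w⟩) ?_
    have hw : P.ν ((w : torsionSub φ l) : Kbar Fq) < 1 := w.2
    change P.ν (φ b ((w : torsionSub φ l) : Kbar Fq) / w₀ - algebraMap (Polynomial Fq) _ b *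
      (((w : torsionSub φ l) : Kbar Fq) / w₀)) < 1
    rw [← mul_div_assoc, ← sub_div, map_div₀, div_lt_one hpos]
    refine (abs_phi_sub_mul_le hq hr hφ hν hA b hw.le).trans_lt ?_
    have h1 := hval w
    rw [map_div₀, div_le_one hpos] at h1
    calc P.ν ((w : torsionSub φ l) : Kbar Fq) ^ 2 ≤ P.ν w₀ ^ 2 := by gcongr
      _ < P.ν w₀ := by
        rw [sq]
        exact mul_lt_of_lt_one_left hpos hw₁
  have hmul : ∀ σ ∈ P.H, ∀ v w u : W, σ w₀ = ((w : torsionSub φ l) : Kbar Fq) →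
      σ ((v : torsionSub φ l) : Kbar Fq) = ((u : torsionSub φ l) : Kbar Fq) → ξ u = ξ v * ξ w := by
    intro σ hσ v w u hw hu
    refine hξ _ (⟨_, hval v⟩ * ⟨_, hval w⟩) ?_
    change P.ν (((u : torsionSub φ l) : Kbar Fq) / w₀ - ((v : torsionSub φ l) : Kbar Fq) / w₀ *
      (((w : torsionSub φ l) : Kbar Fq) / w₀)) < 1
    have hσ0 : σ w₀ ≠ 0 := fun h => h₀ (by rwa [map_eq_zero_iff _ σ.injective] at h)
    have h1 : ((u : torsionSub φ l) : Kbar Fq) / w₀ - ((v : torsionSub φ l) : Kbar Fq) / w₀ *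
      (((w : torsionSub φ l) : Kbar Fq) / w₀) = (σ (((v : torsionSub φ l) : Kbar Fq) / w₀) -
        ((v : torsionSub φ l) : Kbar Fq) / w₀) * (((w : torsionSub φ l) : Kbar Fq) / w₀) := by
      rw [map_div₀, ← hu, ← hw]
      field_simp
    rw [h1, map_mul]
    exact mul_lt_one_of_nonneg_of_lt_one_left (by positivity) (P.inert σ hσ _ (hval v)) (hval w)
  have hstab : ∀ σ ∈ P.H, ∀ w ∈ W, torsionRep hφ l σ w ∈ W := by
    intro σ hσ w hw
    rw [hWmem, coe_torsionRep, P.inv σ hσ]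
    exact hw
  have hex : ∀ w : W, w ≠ 0 → ∃ σ ∈ P.H, σ w₀ = ((w : torsionSub φ l) : Kbar Fq) := fun w hw =>
    htrans _ (w : torsionSub φ l).2 (fun h => hw (by ext; exact h)) w.2
  obtain ⟨w, hw, hdet⟩ := exists_det_eq j ξ hinj hsmul (w₀ := ⟨⟨w₀, hw₀⟩, hw₁⟩)
    (hξ _ 1 (by
      change P.ν (w₀ / w₀ - 1) < 1
      rw [div_self h₀, sub_self, map_zero]
      exact one_pos))
    (fun v w => by
      by_cases hw : w = 0
      · exact ⟨0, by rw [hw, map_zero, mul_zero]⟩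
      · obtain ⟨σ, hσ, h⟩ := hex w hw
        exact ⟨⟨torsionRep hφ l σ v, hstab σ hσ _ v.2⟩, hmul σ hσ _ _ _ h rfl⟩) hb
  obtain ⟨σ, hσ, h⟩ := hex w hw
  refine ⟨σ, hσ, ?_⟩
  rw [det_eq_det_restrict _ W (fun v => hin σ hσ v v.2) (hstab σ hσ)]
  exact hdet _ fun v => hmul σ hσ _ _ _ h rfl

end Tame

section TameDeterminant

variable {Fq : Type} [Field Fq] [Fintype Fq] {q r : ℕ}
  {φ : Polynomial Fq →+* AddMonoid.End (Kbar Fq)}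
  (hq : Fintype.card Fq = q) (hr : 1 < r) (hφ : IsDrinfeldPhi Fq q r φ)
include hq hr hφ

theorem exists_det_X [Fact (Irreducible (X : Polynomial Fq))] {a : Polynomial Fq}
    (ha : 0 < a.natDegree) (hXa : ¬ X ∣ a) {b : AdjoinRoot (X : Polynomial Fq)} (hb : b ≠ 0) :
    ∃ σ : Kbar Fq ≃ₐ[RatFunc Fq] Kbar Fq,
      LinearMap.det (torsionRep hφ X σ : torsionSub φ X →ₗ[AdjoinRoot X] torsionSub φ X) = b ∧
      ∀ x, φ a x = 0 → σ (σ x - x) = σ x - x := by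
  have hq1 : 1 < q := hq ▸ Fintype.one_lt_card
  obtain ⟨P, hA, hunit, hs, -⟩ := exists_finitePlace (Fq := Fq) irreducible_X one_pos
  rw [pow_one] at hs
  have hX : P.ν (algebraMap (Polynomial Fq) _ X) < 1 := hs ▸ P.s_lt_one
  have hd : 0 < (X : Polynomial Fq).natDegree := by simp
  obtain ⟨z, -, -, -, hcard, -⟩ := exists_torsion_generator hq hr hφ P.nonarch hX
    (abs_const_of_unit hunit) hA hunit hd
  set S := {x : Kbar Fq | φ X x = 0 ∧ P.ν x ≤ 1} with hS
  have hSfin : S.Finite := (finite_torsion hq hr hφ X_ne_zero).subset fun x hx => hx.1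
  have h0S : (0 : Kbar Fq) ∈ S := ⟨map_zero _, by simp⟩
  have hJ : 1 < q ^ (r - 1) := Nat.one_lt_pow (by omega) hq1
  rw [natDegree_X, mul_one] at hcard
  have habs : ∀ x ∈ S, x ≠ 0 → P.ν x ^ (q ^ (r - 1) - 1) = P.s := fun x hx hx0 => by
    rw [abs_T_torsion hr hφ P hX hq1 hx.1 hx.2 hx0, hs]
  have hlt : ∀ x ∈ S, P.ν x < 1 := by
    intro x hx
    by_cases hx0 : x = 0
    · simp [hx0]
    · by_contra! h
      exact absurd (one_le_pow₀ h (n := q ^ (r - 1) - 1))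
        (by rw [habs x hx hx0]; exact P.s_lt_one.not_ge)
  obtain ⟨w₀, hw₀, h₀⟩ := Set.exists_ne_of_one_lt_ncard (hcard ▸ hJ) 0
  have hdiff : (S \ {0}).ncard ≤ q ^ (r - 1) - 1 := by
    rw [Set.ncard_sdiff_singleton_of_mem h0S, hcard]
  obtain ⟨σ, hσ, hdet⟩ := exists_det_of_transitive hq hr hφ P hA hX hw₀.1 h₀ (hlt _ hw₀)
    (fun w hw hw0 hw1 => P.orbit_eq (separable_minpoly_torsion hq hr hφ X_ne_zero hw₀.1) h₀
      (habs w₀ hw₀ h₀) (S := S \ {0}) hSfin.sdiff hdiff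
      (fun σ hσ => ⟨⟨by rw [phi_equiv hφ, hw₀.1, map_zero], by rw [P.inv σ hσ]; exact hw₀.2⟩,
        fun h => h₀ ((map_eq_zero_iff _ σ.injective).1 h)⟩) ⟨⟨hw, hw1.le⟩, hw0⟩)
    (fun σ hσ x hx => hlt _ ⟨by rw [map_sub, phi_equiv hφ, hx, map_zero, sub_zero],
      inertia_sub_integral hq hr hφ P hA hunit hX hd hx hσ⟩) hb
  refine ⟨σ, hdet, fun x hx => ?_⟩
  exact inertia_fixes_torsion hq hr hφ P hA (hunit a hXa)
    (by rw [map_sub, phi_equiv hφ, hx, map_zero, sub_zero])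
    (inertia_sub_integral hq hr hφ P hA hunit hX ha hx hσ) hσ

theorem exists_det_of_not_dvd_X {l : Polynomial Fq} [hl : Fact (Irreducible l)] (hlX : ¬ l ∣ X)
    {a : Polynomial Fq} (hla : ¬ l ∣ a) {b : AdjoinRoot l} (hb : b ≠ 0) :
    ∃ σ : Kbar Fq ≃ₐ[RatFunc Fq] Kbar Fq,
      LinearMap.det (torsionRep hφ l σ : torsionSub φ l →ₗ[AdjoinRoot l] torsionSub φ l) = b ∧
      ∀ x, φ a x = 0 → σ x = x := by
  classical
  have hq1 : 1 < q := hq ▸ Fintype.one_lt_card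
  have hl0 : l ≠ 0 := hl.out.ne_zero
  obtain ⟨P, hA, hunit, hs, -⟩ := exists_finitePlace (Fq := Fq) hl.out one_pos
  rw [pow_one] at hs
  have hls : P.ν (algebraMap (Polynomial Fq) _ l) < 1 := hs ▸ P.s_lt_one
  have hC : ∀ c : Fq, c ≠ 0 → ¬ l ∣ C c := fun c hc h =>
    hl.out.not_isUnit (isUnit_of_dvd_unit h (isUnit_C.2 hc.isUnit))
  have h_integral : ∀ {c : Polynomial Fq} {x}, c ≠ 0 → φ c x = 0 → P.ν x ≤ 1 := fun hc hx =>
    abs_torsion_le_one hq1 hr hφ P.nonarch hA (hunit _ hlX) (fun c hc => hunit _ (hC c hc)) hc hx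
  set p := torsionPolyBar Fq q r l with hp
  have hpA : ∀ i, P.ν (p.coeff i) ≤ 1 := fun i => by
    rw [hp, coeff_map]
    exact hA _
  have hcoeff1 : p.coeff 1 = algebraMap _ _ l := coeff_torsionPolyBar_one hq hr l
  have hcoeff0 : p.coeff 0 = 0 := coeff_torsionPolyBar_zero hq1 l
  have hlead : P.ν p.leadingCoeff = 1 := by
    obtain ⟨-, m, hm⟩ := natDegree_torsionPoly (r := r) hq1 (by omega) hl0
    rw [hp, torsionPolyBar, leadingCoeff_map_of_injective algebraMap_Kbar_injective, hm]
    refine hunit _ fun h => ?_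
    rcases hl.out.prime.dvd_or_dvd h with h | h
    · exact hC _ (leadingCoeff_ne_zero.2 hl0) h
    · exact hlX (hl.out.prime.dvd_of_dvd_pow h)
  have hex : ∃ i, P.ν (p.coeff i) = 1 := ⟨p.natDegree, hlead⟩
  obtain ⟨J, hJ, hJmin⟩ : ∃ J, P.ν (p.coeff J) = 1 ∧ ∀ i < J, P.ν (p.coeff i) ≠ 1 :=
    ⟨Nat.find hex, Nat.find_spec hex, fun i hi => Nat.find_min hex hi⟩
  have hJ1 : 1 < J := by
    by_contra! h
    interval_cases J
    · rw [hcoeff0, map_zero] at hJ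
      exact zero_ne_one hJ
    · rw [hcoeff1] at hJ
      exact hls.ne hJ
  have hi : ∀ i < J, P.ν (p.coeff i) ≤ P.ν (p.coeff 1) := by
    intro i hi
    have h1 := hJmin i hi
    rw [hcoeff1]
    rw [hp, torsionPolyBar, coeff_map] at h1 ⊢
    have h2 : l ∣ (torsionPoly q r l).coeff i := by
      by_contra h
      exact h1 (hunit _ h)
    obtain ⟨c, hc⟩ := h2
    rw [hc, map_mul, map_mul]
    exact mul_le_of_le_one_right (by positivity) (hA c)
  have heval : ∀ x, p.eval x = φ l x := fun x => eval_torsionPolyBar hφ l x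
  set S := {x : Kbar Fq | φ l x = 0 ∧ P.ν x < 1} with hS
  have hSfin : S.Finite := (finite_torsion hq hr hφ hl0).subset fun x hx => hx.1
  have habs : ∀ x ∈ S, x ≠ 0 → P.ν x ^ (J - 1) = P.s := fun x hx hx0 => by
    rw [nonarch_small_root_pow P.nonarch hJ1 hpA hcoeff0 hJ
      (by rw [hcoeff1]; exact algebraMap_Kbar_ne_zero hl0) hi (by rw [heval]; exact hx.1) hx.2 hx0,
      hcoeff1, hs]
  have hcard : S.ncard ≤ J := by
    rw [Set.ncard_eq_toFinset_card S hSfin]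
    refine (nonarch_card_roots_le P.nonarch hpA hJ fun w hw => ?_).2 fun w hw => ?_
    · rw [heval]
      exact ((hSfin.mem_toFinset).1 hw).1
    · exact ((hSfin.mem_toFinset).1 hw).2
  obtain ⟨w₀, hw₀, h₀⟩ : ∃ w₀ ∈ S, w₀ ≠ 0 := by
    by_contra! hcon
    have hsp := (IsAlgClosed.splits p.divX).coeff_zero_eq_leadingCoeff_mul_prod_roots
    have hc : p.divX.coeff 0 = algebraMap _ _ l := by rw [coeff_divX]; exact hcoeff1
    have hroot : ∀ x ∈ p.divX.roots, 1 ≤ P.ν x := by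
      intro x hx
      have hx' : p.divX.eval x = 0 := (mem_roots'.1 hx).2
      by_contra! hlt
      have hx0 : x ≠ 0 := by
        rintro rfl
        rw [← coeff_zero_eq_eval_zero, hc] at hx'
        exact algebraMap_Kbar_ne_zero hl0 hx'
      refine hx0 (hcon x ⟨?_, hlt⟩)
      rw [← heval, ← divX_mul_X_add p, eval_add, eval_mul, hx', hcoeff0]
      simp
    have hlc : p.divX.leadingCoeff = p.leadingCoeff := by
      rw [leadingCoeff, natDegree_divX_eq_natDegree_tsub_one, coeff_divX, leadingCoeff]
      congr 1
      have : J ≤ p.natDegree := le_natDegree_of_ne_zero fun h => by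
        rw [h, map_zero] at hJ
        exact zero_ne_one hJ
      omega
    have h1 := congrArg P.ν hsp
    rw [hc, hlc, map_mul, map_mul, map_pow, P.ν.map_neg, map_one, one_pow, one_mul, hlead, one_mul,
      map_multiset_prod] at h1
    refine absurd hls (not_lt.2 ?_)
    rw [h1]
    refine Multiset.prod_induction (fun t : ℝ => 1 ≤ t) _ (fun s t => one_le_mul_of_one_le_of_one_le)
      le_rfl ?_
    intro t ht
    obtain ⟨y, hy, rfl⟩ := Multiset.mem_map.1 ht
    exact hroot y hy
  have h0S : (0 : Kbar Fq) ∈ S := ⟨map_zero _, by simp⟩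
  have hdiff : (S \ {0}).ncard ≤ J - 1 := by
    rw [Set.ncard_sdiff_singleton_of_mem h0S]
    omega
  obtain ⟨σ, hσ, hdet⟩ := exists_det_of_transitive hq hr hφ P hA hls hw₀.1 h₀ hw₀.2
    (fun w hw hw0 hw1 => P.orbit_eq (separable_minpoly_torsion hq hr hφ hl0 hw₀.1) h₀
      (habs w₀ hw₀ h₀) (S := S \ {0}) hSfin.sdiff hdiff
      (fun σ hσ => ⟨⟨by rw [phi_equiv hφ, hw₀.1, map_zero], by rw [P.inv σ hσ]; exact hw₀.2⟩,
        fun h => h₀ ((map_eq_zero_iff _ σ.injective).1 h)⟩) ⟨⟨hw, hw1⟩, hw0⟩)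
    (fun σ hσ x hx => P.inert σ hσ x (h_integral hl0 hx)) hb
  refine ⟨σ, hdet, fun x hx => ?_⟩
  have ha0 : a ≠ 0 := by
    rintro rfl
    exact hla (dvd_zero l)
  exact inertia_fixes_torsion hq hr hφ P hA (hunit a hla) hx (h_integral ha0 hx) hσ

/-- The inertia group at a prime `l` attains all determinants on the `l`-torsion, and it has
determinant one on the torsion at other primes. -/
theorem exists_det_and_det_eq_one {l l' : Polynomial Fq} [Fact (Irreducible l)]
    [hl' : Fact (Irreducible l')] (hm : l.Monic) (h : ¬ l ∣ l') {b : AdjoinRoot l} (hb : b ≠ 0) :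
    ∃ σ : Kbar Fq ≃ₐ[RatFunc Fq] Kbar Fq,
      LinearMap.det (torsionRep hφ l σ : torsionSub φ l →ₗ[AdjoinRoot l] torsionSub φ l) = b ∧
      LinearMap.det (torsionRep hφ l' σ : torsionSub φ l' →ₗ[AdjoinRoot l'] torsionSub φ l') = 1 := by
  have := finite_torsionSub hq hr hφ hl'.out.ne_zero
  have : FiniteDimensional (AdjoinRoot l') (torsionSub φ l') := Module.Finite.of_finite
  by_cases hlX : l ∣ X
  · obtain rfl : l = X := eq_of_monic_of_associated hm monic_X
      ((Fact.out : Irreducible l).associated_of_dvd irreducible_X hlX)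
    obtain ⟨σ, hσ, h1⟩ := exists_det_X hq hr hφ hl'.out.natDegree_pos h hb
    exact ⟨σ, hσ, det_eq_one_of_unipotent _ fun v => Subtype.ext (h1 v v.2)⟩
  · obtain ⟨σ, hσ, h1⟩ := exists_det_of_not_dvd_X hq hr hφ hlX h hb
    refine ⟨σ, hσ, ?_⟩
    have : (torsionRep hφ l' σ : torsionSub φ l' →ₗ[AdjoinRoot l'] torsionSub φ l') =
        LinearMap.id := LinearMap.ext fun v => Subtype.ext (h1 v v.2)
    rw [this, LinearMap.det_id]

end TameDeterminant

section Surjectivity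

variable {Fq : Type} [Field Fq] [Fintype Fq] {q r : ℕ}
  {φ : Polynomial Fq →+* AddMonoid.End (Kbar Fq)}
  (hq : Fintype.card Fq = q) (hq2 : 2 < q) (hr : 1 < r) (hφ : IsDrinfeldPhi Fq q r φ)
include hq hq2 hr hφ

/-- Automorphisms of determinant one of the `l`-torsion are realised by Galois automorphisms
which are trivial on the `l'`-torsion. -/
theorem exists_galois_of_det_eq_one {l l' : Polynomial Fq} [hl : Fact (Irreducible l)]
    [hl' : Fact (Irreducible l')] (h : IsCoprime l l')
    {g : torsionSub φ l ≃ₗ[AdjoinRoot l] torsionSub φ l} (hg : LinearEquiv.det g = 1) :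
    ∃ σ, torsionRep hφ l σ = g ∧ torsionRep hφ l' σ = 1 := by
  have hl0 : l ≠ 0 := hl.out.ne_zero
  have := finite_torsionSub hq hr hφ hl0
  have : FiniteDimensional (AdjoinRoot l) (torsionSub φ l) := Module.Finite.of_finite
  obtain ⟨P, hA, hunit, hX, z₀, hz, hz1, hgen, htr⟩ := exists_transvections hq hr hφ hl.out hl'.out h
  let z : torsionSub φ l := ⟨z₀, hz⟩
  let W : Submodule (AdjoinRoot l) (torsionSub φ l) :=
    { carrier := {x | P.ν (x : Kbar Fq) ≤ 1}
      add_mem' := fun {x y} hx hy => (P.nonarch x y).trans (max_le hx hy)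
      zero_mem' := by simp
      smul_mem' := by
        intro c x hx
        obtain ⟨b, rfl⟩ := AdjoinRoot.mk_surjective c
        exact abs_phi_le_one hφ P.nonarch hA b hx }
  have hzW : z ∉ W := not_le.2 hz1
  have hdec : ∀ v : torsionSub φ l, ∃ c : AdjoinRoot l, ∃ w ∈ W, v = w + c • z := by
    intro v
    obtain ⟨b, hb⟩ := hgen v v.2
    exact ⟨AdjoinRoot.mk l b, v - AdjoinRoot.mk l b • z, hb, (sub_add_cancel _ _).symm⟩
  obtain ⟨f, hf, hWf⟩ := Submodule.exists_le_ker_of_notMem hzW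
  let f₀ : Module.Dual (AdjoinRoot l) (torsionSub φ l) := (f z)⁻¹ • f
  have hf₀W : ∀ w ∈ W, f₀ w = 0 := fun w hw => by
    have : f w = 0 := hWf hw
    simp [f₀, this]
  have hf₀z : f₀ z = 1 := by simp [f₀, hf]
  have hf₀ : ∀ w ∈ W, ∀ c : AdjoinRoot l, f₀ (w + c • z) = c := fun w hw c => by
    simp [hf₀W w hw, hf₀z]
  have hker : ∀ w, f₀ w = 0 → w ∈ W := by
    intro v hv
    obtain ⟨c, w, hw, rfl⟩ := hdec v
    rw [hf₀ w hw] at hv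
    rwa [hv, zero_smul, add_zero]
  have htrans : ∀ w ∈ W, ∃ σ ∈ (torsionRep hφ l').ker, ∀ v,
      torsionRep hφ l σ v = v + f₀ v • w := by
    intro w hw
    obtain ⟨σ, hσW, hσz, hσ'⟩ := htr w w.2 hw
    refine ⟨σ, LinearEquiv.ext fun v => Subtype.ext (hσ' v v.2), fun v => ?_⟩
    obtain ⟨c, u, hu, rfl⟩ := hdec v
    have h1 : torsionRep hφ l σ u = u := Subtype.ext (hσW u u.2 hu)
    have h2 : torsionRep hφ l σ z = z + w := Subtype.ext hσz
    rw [hf₀ u hu, map_add, map_smul, h1, h2, smul_add, add_assoc]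
  obtain ⟨σ, hσ, h1⟩ := exists_mem_normal_of_det_eq_one (torsionRep hφ l) (torsionRep hφ l').ker
    (f₀ := f₀) (fun h => one_ne_zero (hf₀z.symm.trans (by rw [h]; rfl)))
    (fun w hw => htrans w (hker w hw))
    (fun U hU => by
      rw [or_iff_not_imp_left]
      intro hne
      obtain ⟨u, huU, hu0⟩ := Submodule.exists_mem_ne_zero_of_ne_bot hne
      obtain ⟨σ, hσ⟩ := exists_conj_not_integral hq2 hr hφ hA hunit hX hl0 u.2
        (fun h => hu0 (Subtype.ext h))
      have hu'U : torsionRep hφ l σ u ∈ U := hU σ u huU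
      have hu'W : torsionRep hφ l σ u ∉ W := not_le.2 hσ
      generalize torsionRep hφ l σ u = u' at hu'U hu'W
      have hc : f₀ u' ≠ 0 := fun h => hu'W (hker _ h)
      have hWU : W ≤ U := by
        intro w hw
        obtain ⟨τ, -, hτ⟩ := htrans w hw
        have h2 := U.sub_mem (hU τ u' hu'U) hu'U
        rw [hτ, add_sub_cancel_left] at h2
        exact (U.smul_mem_iff hc).1 h2
      obtain ⟨c, w, hw, rfl⟩ := hdec u'
      rw [hf₀ w hw] at hc
      have hzU : z ∈ U := (U.smul_mem_iff hc).1 ((U.add_mem_iff_right (hWU hw)).1 hu'U)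
      refine eq_top_iff.2 fun v _ => ?_
      obtain ⟨c, w, hw, rfl⟩ := hdec v
      exact U.add_mem (hWU hw) (U.smul_mem _ hzU))
    (g := g) (by rw [← LinearEquiv.coe_det, hg, Units.val_one])
  exact ⟨σ, h1, hσ⟩

theorem exists_galois_of_torsion_equiv {l₁ l₂ : Polynomial Fq} [h₁ : Fact (Irreducible l₁)]
    [h₂ : Fact (Irreducible l₂)] (hm₁ : l₁.Monic) (hm₂ : l₂.Monic) (h : IsCoprime l₁ l₂)
    (g₁ : torsionSub φ l₁ ≃ₗ[AdjoinRoot l₁] torsionSub φ l₁)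
    (g₂ : torsionSub φ l₂ ≃ₗ[AdjoinRoot l₂] torsionSub φ l₂) :
    ∃ σ, torsionRep hφ l₁ σ = g₁ ∧ torsionRep hφ l₂ σ = g₂ := by
  have hd₁ : ¬ l₁ ∣ l₂ := fun hd => h₁.out.not_isUnit (h.isUnit_of_dvd' dvd_rfl hd)
  have hd₂ : ¬ l₂ ∣ l₁ := fun hd => h₂.out.not_isUnit (h.isUnit_of_dvd' hd dvd_rfl)
  obtain ⟨σ₁, ha₁, hb₁⟩ := exists_det_and_det_eq_one hq hr hφ hm₁ hd₁
    (LinearEquiv.det g₁).ne_zero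
  obtain ⟨σ₂, ha₂, hb₂⟩ := exists_det_and_det_eq_one hq hr hφ hm₂ hd₂
    (LinearEquiv.det g₂).ne_zero
  rw [← LinearEquiv.coe_det, Units.val_inj] at ha₁ ha₂
  rw [← LinearEquiv.coe_det, Units.val_eq_one] at hb₁ hb₂
  obtain ⟨n₁, hn₁, hn₁'⟩ := exists_galois_of_det_eq_one hq hq2 hr hφ h
    (g := g₁ * (torsionRep hφ l₁ (σ₁ * σ₂))⁻¹) (by simp [ha₁, hb₂])
  obtain ⟨n₂, hn₂, hn₂'⟩ := exists_galois_of_det_eq_one hq hq2 hr hφ h.symm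
    (g := g₂ * (torsionRep hφ l₂ (σ₁ * σ₂))⁻¹) (by simp [ha₂, hb₁])
  refine ⟨n₁ * n₂ * (σ₁ * σ₂), ?_, ?_⟩
  · rw [map_mul _ (n₁ * n₂), map_mul _ n₁, hn₁, hn₂', mul_one, inv_mul_cancel_right]
  · rw [map_mul _ (n₁ * n₂), map_mul _ n₁, hn₁', hn₂, one_mul, inv_mul_cancel_right]

omit hq2

theorem exists_torsion_equiv_of_isTorsionAut {a l : Polynomial Fq} (hl : l ≠ 0) (hla : l ∣ a)
    {g : Kbar Fq → Kbar Fq} (hg : IsTorsionAut Fq φ a g) :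
    ∃ e : torsionSub φ l ≃ₗ[AdjoinRoot l] torsionSub φ l, ∀ x, (e x : Kbar Fq) = g x := by
  obtain ⟨hbij, hadd, hsmul⟩ := hg
  have hmem : ∀ x : torsionSub φ l, (x : Kbar Fq) ∈ phiTorsion Fq φ a := by
    rintro ⟨x, hx⟩
    obtain ⟨c, rfl⟩ := hla
    change φ (l * c) x = 0
    rw [mul_comm, phi_mul_apply, mem_torsionSub.1 hx, map_zero]
  have hg0 : g 0 = 0 := by
    have h1 := hsmul 0 0 (map_zero (φ a))
    rwa [phi_zero_apply, phi_zero_apply] at h1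
  let f : torsionSub φ l →ₗ[AdjoinRoot l] torsionSub φ l :=
    { toFun x := ⟨g x, by rw [mem_torsionSub, ← hsmul _ _ (hmem x), mem_torsionSub.1 x.2, hg0]⟩
      map_add' x y := Subtype.ext (hadd _ (hmem x) _ (hmem y))
      map_smul' c x := by
        obtain ⟨b, rfl⟩ := AdjoinRoot.mk_surjective c
        exact Subtype.ext (hsmul b _ (hmem x)) }
  have hf : Function.Injective f := fun x y h =>
    Subtype.ext (hbij.injOn (hmem x) (hmem y) (congrArg Subtype.val h))
  have := finite_torsionSub hq hr hφ hl
  exact ⟨LinearEquiv.ofBijective f (Finite.injective_iff_bijective.1 hf), fun x => rfl⟩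

end Surjectivity

/-- There is `c = c(r)` such that for `p > c` and `q ≡ 1 (mod r)`: for any two distinct
nonzero primes `𝔩₁ = (l₁) ≠ 𝔩₂ = (l₂)` of `A`, every `A/(𝔩₁𝔩₂)`-module automorphism of
`φ[𝔩₁𝔩₂]` is the restriction of some `σ ∈ Gal(F̄/F)`. -/
theorem mod_l1_l2_galois_representation_surjective (r : ℕ) (hr : r.Prime) (hr3 : 3 ≤ r) :
    ∃ c : ℕ, ∀ (p e q : ℕ), p.Prime → 5 ≤ p → c < p → 0 < e → q = p ^ e → q % r = 1 →
    ∀ (Fq : Type) [Field Fq] [Fintype Fq], Fintype.card Fq = q →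
    ∀ φ : Polynomial Fq →+* AddMonoid.End (Kbar Fq), IsDrinfeldPhi Fq q r φ →
    ∀ l₁ l₂ : Polynomial Fq, l₁.Monic → Irreducible l₁ → l₂.Monic → Irreducible l₂ →
    l₁ ≠ l₂ →
    ∀ g : Kbar Fq → Kbar Fq, IsTorsionAut Fq φ (l₁ * l₂) g →
    ∃ σ : Kbar Fq ≃ₐ[RatFunc Fq] Kbar Fq, ∀ x ∈ phiTorsion Fq φ (l₁ * l₂), σ x = g x := by
  refine ⟨0, ?_⟩
  intro p e q _ hp5 _ he hpq _ Fq _ _ hq φ hφ l₁ l₂ hm₁ h₁ hm₂ h₂ hne g hg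
  have hq2 : 2 < q := by
    have : p ^ 1 ≤ p ^ e := Nat.pow_le_pow_right (by omega) he
    rw [pow_one] at this
    omega
  have hr1 : 1 < r := by omega
  have hcop : IsCoprime l₁ l₂ := (h₁.coprime_iff_not_dvd).2 fun hd =>
    hne (eq_of_monic_of_associated hm₁ hm₂ (h₁.associated_of_dvd h₂ hd))
  have := Fact.mk h₁
  have := Fact.mk h₂
  obtain ⟨g₁, hg₁⟩ := exists_torsion_equiv_of_isTorsionAut hq hr1 hφ h₁.ne_zero
    (dvd_mul_right l₁ l₂) hg
  obtain ⟨g₂, hg₂⟩ := exists_torsion_equiv_of_isTorsionAut hq hr1 hφ h₂.ne_zero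
    (dvd_mul_left l₂ l₁) hg
  obtain ⟨σ, hσ₁, hσ₂⟩ := exists_galois_of_torsion_equiv hq hq2 hr1 hφ hm₁ hm₂ hcop g₁ g₂
  refine ⟨σ, fun x hx => ?_⟩
  have hx' : φ (l₁ * l₂) x = 0 := hx
  obtain ⟨u, v, huv⟩ := hcop
  have h1 : φ l₁ (φ (v * l₂) x) = 0 := by
    rw [← phi_mul_apply, show l₁ * (v * l₂) = v * (l₁ * l₂) by ring, phi_mul_apply, hx', map_zero]
  have h2 : φ l₂ (φ (u * l₁) x) = 0 := by
    rw [← phi_mul_apply, show l₂ * (u * l₁) = u * (l₁ * l₂) by ring, phi_mul_apply, hx', map_zero]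
  have h3 : x = φ (u * l₁) x + φ (v * l₂) x := by
    rw [← phi_add_apply, huv, phi_one_apply]
  have hs1 : σ (φ (v * l₂) x) = g (φ (v * l₂) x) := by
    rw [← hg₁ ⟨_, h1⟩, ← hσ₁, coe_torsionRep]
  have hs2 : σ (φ (u * l₁) x) = g (φ (u * l₁) x) := by
    rw [← hg₂ ⟨_, h2⟩, ← hσ₂, coe_torsionRep]
  have hmem : ∀ b, φ b x ∈ phiTorsion Fq φ (l₁ * l₂) := fun b => by
    change φ (l₁ * l₂) (φ b x) = 0
    rw [phi_comm, hx', map_zero]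
  rw [h3, map_add, hs1, hs2, hg.2.1 _ (hmem _) _ (hmem _)]
end
end

section
/- Let k ≥ 2 and let S₁, …, S_k be finite groups each having no nontrivial abelian quotient (equivalently, each S_i equals its own commutator subgroup). Let H be a subgroup of S₁ × ⋯ × S_k such that for all 1 ≤ i < j ≤ k the projection H → S_i × S_j is surjective. Then H = S₁ × ⋯ × S_k. -/
/-- If each `S i` is perfect and every element of `S i` lifts to `H` with trivial `j`-th
coordinate, for each `j ≠ i`, then it also lifts with trivial coordinates on any finite set of
indices avoiding `i`. -/
theorem Subgroup.map_eval_inf_pi_bot_eq_top {ι : Type*} {S : ι → Type*} [∀ i, Group (S i)]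
    (H : Subgroup (∀ i, S i)) (i : ι) (hS : _root_.commutator (S i) = ⊤)
    (hi : ∀ s : S i, ∃ h ∈ H, h i = s)
    (hij : ∀ j, j ≠ i → ∀ s : S i, ∃ h ∈ H, h i = s ∧ h j = 1)
    (T : Finset ι) (hT : i ∉ T) :
    (H ⊓ Subgroup.pi (T : Set ι) fun _ => ⊥).map (Pi.evalMonoidHom S i) = ⊤ := by
  classical
  induction T using Finset.induction_on with
  | empty =>
    refine eq_top_iff.2 fun s _ => ?_
    obtain ⟨h, hH, rfl⟩ := hi s
    exact ⟨h, ⟨hH, by simp [Subgroup.mem_pi]⟩, rfl⟩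
  | insert j T _ ih =>
    rw [Finset.mem_insert, not_or] at hT
    rw [eq_top_iff, ← hS, _root_.commutator_def, Subgroup.commutator_le]
    intro a _ b _
    obtain ⟨g, ⟨hgH, hgT⟩, rfl⟩ := (Subgroup.eq_top_iff' _).1 (ih hT.2) a
    obtain ⟨h, hhH, rfl, hhj⟩ := hij j (Ne.symm hT.1) b
    refine ⟨g * h * g⁻¹ * h⁻¹, ⟨?_, fun l hl => ?_⟩, rfl⟩
    · exact H.mul_mem (H.mul_mem (H.mul_mem hgH hhH) (H.inv_mem hgH)) (H.inv_mem hhH)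
    · change g l * h l * (g l)⁻¹ * (h l)⁻¹ = 1
      rcases Finset.mem_insert.1 (Finset.mem_coe.1 hl) with rfl | hl
      · simp [hhj]
      · simp [show g l = 1 from hgT l hl]


/-- Goursat-type lemma: if `S₁, …, S_k` (`k ≥ 2`) are finite groups equal to their own
commutator subgroups (no nontrivial abelian quotients) and `H ≤ S₁ × ⋯ × S_k` surjects
onto `S_i × S_j` for all `i < j`, then `H = S₁ × ⋯ × S_k`. -/
theorem subgroup_of_product_eq_top_of_pairwise_surjective
    (k : ℕ) (hk : 2 ≤ k) (S : Fin k → Type) [∀ i, Group (S i)] [∀ i, Finite (S i)]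
    (hS : ∀ i, commutator (S i) = ⊤)
    (H : Subgroup (∀ i, S i))
    (hsurj : ∀ i j : Fin k, i < j →
      Function.Surjective (fun h : H => (((h : ∀ i, S i) i, (h : ∀ i, S i) j) : S i × S j))) :
    H = ⊤ := by
  have hij : ∀ i j, j ≠ i → ∀ s : S i, ∃ h ∈ H, h i = s ∧ h j = 1 := by
    intro i j hne s
    rcases lt_or_gt_of_ne hne with hlt | hlt
    · obtain ⟨h, hh⟩ := hsurj j i hlt (1, s)
      exact ⟨h, h.2, congrArg Prod.snd hh, congrArg Prod.fst hh⟩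
    · obtain ⟨h, hh⟩ := hsurj i j hlt (s, 1)
      exact ⟨h, h.2, congrArg Prod.fst hh, congrArg Prod.snd hh⟩
  have : Nontrivial (Fin k) := Fin.nontrivial_iff_two_le.2 hk
  refine eq_top_iff.2 fun x _ => Subgroup.pi_mem_of_mulSingle_mem x fun i => ?_
  have hi : ∀ s : S i, ∃ h ∈ H, h i = s := fun s => by
    obtain ⟨j, hj⟩ := exists_ne i
    obtain ⟨h, hH, hs, _⟩ := hij i j hj s
    exact ⟨h, hH, hs⟩
  obtain ⟨h, ⟨hH, hT⟩, hx⟩ := (Subgroup.eq_top_iff' _).1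
    (H.map_eval_inf_pi_bot_eq_top i (hS i) hi (hij i) (Finset.univ.erase i) (by simp)) (x i)
  suffices Pi.mulSingle i (x i) = h from this ▸ hH
  ext j
  rcases eq_or_ne j i with rfl | hne
  · rw [Pi.mulSingle_eq_same]
    exact hx.symm
  · rw [Pi.mulSingle_eq_of_ne hne]
    exact (show h j = 1 from hT j (by simp [hne])).symm
end
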